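/- arXiv:0902.4561 — 6 statements merged into one kernel-verified Lean document; each statement's English description precedes it below -/
import Mathlib

section
/- Let f : [0,1] → ℝ be continuously differentiable and let M = ∫₀¹ f(x) dx. Then ∫₀¹ (f(x) − M)² dx ≤ ∫₀¹ f′(x)² dx. -/
theorem stmt_8 (f f' : ℝ → ℝ)
    (hderiv : ∀ x ∈ Set.Icc (0 : ℝ) 1, HasDerivWithinAt f (f' x) (Set.Icc (0 : ℝ) 1) x)
    (hcont : ContinuousOn f' (Set.Icc (0 : ℝ) 1))
    (M : ℝ) (hM : M = ∫ x in (0 : ℝ)..1, f x) :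
    (∫ x in (0 : ℝ)..1, (f x - M) ^ 2) ≤ ∫ x in (0 : ℝ)..1, (f' x) ^ 2 := by
  have hf : ContinuousOn f (Set.Icc (0 : ℝ) 1) := fun x hx => (hderiv x hx).continuousWithinAt
  have key : ∀ x ∈ Set.Icc (0 : ℝ) 1,
      (f x - f 0) ^ 2 ≤ ∫ t in (0 : ℝ)..1, (f' t) ^ 2 := by
    intro x hx
    have hsub : Set.Icc (0 : ℝ) x ⊆ Set.Icc (0 : ℝ) 1 := Set.Icc_subset_Icc_right hx.2
    have hc : ContinuousOn f' (Set.Icc (0 : ℝ) x) := hcont.mono hsub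
    have i1 : IntervalIntegrable f' MeasureTheory.volume 0 x :=
      hc.intervalIntegrable_of_Icc hx.1
    have i2 : IntervalIntegrable (fun t => (f' t) ^ 2) MeasureTheory.volume 0 x :=
      (hc.pow 2).intervalIntegrable_of_Icc hx.1
    have i3 : IntervalIntegrable (fun t => (f' t) ^ 2) MeasureTheory.volume 0 1 :=
      (hcont.pow 2).intervalIntegrable_of_Icc zero_le_one
    have ftc : ∫ t in (0 : ℝ)..x, f' t = f x - f 0 := by
      apply intervalIntegral.integral_eq_sub_of_hasDerivAt_of_le hx.1 (hf.mono hsub) _ i1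
      intro t ht
      have ht' : t < 1 := lt_of_lt_of_le ht.2 hx.2
      exact (hderiv t ⟨ht.1.le, ht'.le⟩).hasDerivAt (Icc_mem_nhds ht.1 ht')
    set d := f x - f 0 with hd
    have h0 : 0 ≤ ∫ t in (0 : ℝ)..x, (f' t - d) ^ 2 :=
      intervalIntegral.integral_nonneg hx.1 (fun t _ => sq_nonneg _)
    have h1 : ∫ t in (0 : ℝ)..x, (f' t - d) ^ 2
        = (∫ t in (0 : ℝ)..x, (f' t) ^ 2) - 2 * d * d + x * d ^ 2 := by
      have e : ∀ t, (f' t - d) ^ 2 = (f' t) ^ 2 - 2 * d * f' t + d ^ 2 := fun t => by ring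
      simp_rw [e]
      rw [intervalIntegral.integral_add (i2.sub (i1.const_mul _)) (by simp),
        intervalIntegral.integral_sub i2 (i1.const_mul _),
        intervalIntegral.integral_const_mul, ftc]
      simp
    have h2 : ∫ t in (0 : ℝ)..x, (f' t) ^ 2 ≤ ∫ t in (0 : ℝ)..1, (f' t) ^ 2 :=
      intervalIntegral.integral_mono_interval le_rfl hx.1 hx.2
        (Filter.Eventually.of_forall fun t => sq_nonneg _) i3
    nlinarith [mul_le_mul_of_nonneg_right hx.2 (sq_nonneg d)]
  have j1 : IntervalIntegrable (fun x => (f x - f 0) ^ 2) MeasureTheory.volume 0 1 :=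
    ((hf.sub continuousOn_const).pow 2).intervalIntegrable_of_Icc zero_le_one
  have j2 : IntervalIntegrable (fun x => (f x - M) ^ 2) MeasureTheory.volume 0 1 :=
    ((hf.sub continuousOn_const).pow 2).intervalIntegrable_of_Icc zero_le_one
  have j3 : IntervalIntegrable f MeasureTheory.volume 0 1 :=
    hf.intervalIntegrable_of_Icc zero_le_one
  have v : ∫ x in (0 : ℝ)..1, (f x - f 0) ^ 2
      = (∫ x in (0 : ℝ)..1, (f x - M) ^ 2) + (M - f 0) ^ 2 := by
    have e : ∀ x, (f x - f 0) ^ 2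
        = (f x - M) ^ 2 + 2 * (M - f 0) * f x + (-2 * (M - f 0) * M + (M - f 0) ^ 2) :=
      fun x => by ring
    simp_rw [e]
    rw [intervalIntegral.integral_add (j2.add (j3.const_mul _)) (by simp),
      intervalIntegral.integral_add j2 (j3.const_mul _),
      intervalIntegral.integral_const_mul, ← hM, intervalIntegral.integral_const]
    simp only [smul_eq_mul]
    ring
  have w : ∫ x in (0 : ℝ)..1, (f x - f 0) ^ 2
      ≤ ∫ _x in (0 : ℝ)..1, (∫ t in (0 : ℝ)..1, (f' t) ^ 2) :=
    intervalIntegral.integral_mono_on zero_le_one j1 (by simp) key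
  rw [intervalIntegral.integral_const] at w
  simp only [smul_eq_mul, sub_zero, one_mul] at w
  nlinarith [sq_nonneg (M - f 0)]
end

section
/- Let α ∈ ℝ, ε > 0, and M ∈ ℝ. Suppose ρ : [0,1] × [0,∞) → ℝ is continuous, the partial derivatives ∂ₓρ, ∂ₜρ and ∂ₓ(D(α,ρ)∂ₓρ) exist and are continuous on [0,1] × [0,∞), and: (a) ∂ₜρ = ∂ₓ(D(α,ρ)∂ₓρ) on [0,1] × [0,∞); (b) ∂ₓρ(0,t) = ∂ₓρ(1,t) = 0 for all t ≥ 0; (c) D(α,ρ(x,t)) ≥ ε for all (x,t); (d) ∫₀¹ ρ(x,0) dx = M. Then for every t ≥ 0 one has ∫₀¹ ρ(x,t) dx = M and ∫₀¹ (ρ(x,t) − M)² dx ≤ e^{−2εt} ∫₀¹ (ρ(x,0) − M)² dx. -/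
open MeasureTheory

/-- The diffusivity `D(α,ρ) = 3αρ² − 4αρ + 1`. -/
def Dcoef (α ρ : ℝ) : ℝ := 3 * α * ρ ^ 2 - 4 * α * ρ + 1

theorem aux_param (g gt : ℝ → ℝ → ℝ)
    (hg : ContinuousOn (fun p : ℝ × ℝ => g p.1 p.2) (Set.Icc 0 1 ×ˢ Set.Ici 0))
    (hgt : ContinuousOn (fun p : ℝ × ℝ => gt p.1 p.2) (Set.Icc 0 1 ×ˢ Set.Ici 0))
    (hd : ∀ t ∈ Set.Ici (0 : ℝ), ∀ x ∈ Set.Icc (0 : ℝ) 1,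
      HasDerivWithinAt (fun τ => g x τ) (gt x t) (Set.Ici (0 : ℝ)) t) :
    ContinuousOn (fun t => ∫ x in (0 : ℝ)..1, g x t) (Set.Ici 0) ∧
    ∀ t, 0 < t → HasDerivAt (fun t => ∫ x in (0 : ℝ)..1, g x t)
      (∫ x in (0 : ℝ)..1, gt x t) t := by
  have hP : ∀ x : ℝ, max 0 (min x 1) ∈ Set.Icc (0 : ℝ) 1 := fun x =>
    ⟨le_max_left _ _, max_le zero_le_one (min_le_right _ _)⟩
  have hPid : ∀ x ∈ Set.Icc (0 : ℝ) 1, max 0 (min x 1) = x := fun x hx => by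
    rw [min_eq_left hx.2, max_eq_right hx.1]
  have ext : ∀ h : ℝ → ℝ → ℝ,
      ContinuousOn (fun p : ℝ × ℝ => h p.1 p.2) (Set.Icc 0 1 ×ˢ Set.Ici 0) →
      Continuous (fun p : ℝ × ℝ => h (max 0 (min p.1 1)) (max p.2 0)) := by
    intro h hh
    exact hh.comp_continuous (f := fun p : ℝ × ℝ => (max 0 (min p.1 1), max p.2 0))
      (by fun_prop) (fun p => ⟨hP _, Set.mem_Ici.2 (le_max_right _ _)⟩)
  have cg := ext g hg
  have cgt := ext gt hgt
  have eqI : ∀ h : ℝ → ℝ → ℝ, ∀ t, 0 ≤ t → (∫ x in (0 : ℝ)..1, h x t) =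
      ∫ x in (0 : ℝ)..1, h (max 0 (min x 1)) (max t 0) := by
    intro h t ht
    apply intervalIntegral.integral_congr
    intro x hx
    rw [Set.uIcc_of_le zero_le_one] at hx
    simp only [hPid x hx, max_eq_left ht]
  constructor
  · have : Continuous (fun t => ∫ x in (0 : ℝ)..1, g (max 0 (min x 1)) (max t 0)) := by
      apply intervalIntegral.continuous_parametric_intervalIntegral_of_continuous'
        (f := fun t x => g (max 0 (min x 1)) (max t 0))
      exact cg.comp (continuous_swap)
    exact this.continuousOn.congr (fun t ht => eqI g t ht)
  · intro t ht
    obtain ⟨C, hC⟩ := ((isCompact_Icc (a := (0:ℝ)) (b := 1)).prod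
      (isCompact_Icc (a := t/2) (b := 2*t))).exists_bound_of_continuousOn cgt.continuousOn
    have key := (intervalIntegral.hasDerivAt_integral_of_dominated_loc_of_deriv_le
      (μ := volume) (a := 0) (b := 1) (x₀ := t) (s := Set.Ioo (t/2) (2*t))
      (F := fun t x => g (max 0 (min x 1)) (max t 0))
      (F' := fun t x => gt (max 0 (min x 1)) (max t 0)) (bound := fun _ => C)
      (Ioo_mem_nhds (by linarith) (by linarith))
      (Filter.Eventually.of_forall fun τ =>
        (cg.comp (by fun_prop : Continuous fun x : ℝ => (x, τ))).aestronglyMeasurable)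
      ((cg.comp (by fun_prop : Continuous fun x : ℝ => (x, t))).intervalIntegrable _ _)
      ((cgt.comp (by fun_prop : Continuous fun x : ℝ => (x, t))).aestronglyMeasurable)
      (Filter.Eventually.of_forall fun x hx τ hτ => ?_)
      (by simp)
      (Filter.Eventually.of_forall fun x hx τ hτ => ?_)).2
    · rw [eqI gt t ht.le]
      refine key.congr_of_eventuallyEq ?_
      filter_upwards [Ioi_mem_nhds ht] with τ hτ
      exact eqI g τ (le_of_lt hτ)
    · rw [Set.uIoc_of_le zero_le_one] at hx
      exact hC (x, τ) ⟨⟨hx.1.le, hx.2⟩, ⟨hτ.1.le, hτ.2.le⟩⟩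
    · have hτ0 : 0 < τ := by linarith [hτ.1]
      have := (hd τ hτ0.le _ (hP x)).hasDerivAt (Ici_mem_nhds hτ0)
      simp only [max_eq_left hτ0.le]
      refine this.congr_of_eventuallyEq ?_
      filter_upwards [Ioi_mem_nhds hτ0] with s hs
      rw [max_eq_left (show (0:ℝ) ≤ s from le_of_lt hs)]

theorem aux_anti (J J' : ℝ → ℝ) (hc : ContinuousOn J (Set.Ici 0))
    (hd : ∀ t, 0 < t → HasDerivAt J (J' t) t) (hn : ∀ t, 0 < t → J' t ≤ 0) :
    ∀ t, 0 ≤ t → J t ≤ J 0 := by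
  intro t ht
  refine antitoneOn_of_deriv_nonpos (convex_Ici 0) hc ?_ ?_ (Set.self_mem_Ici) ht ht
  · intro x hx
    rw [interior_Ici] at hx
    exact (hd x hx).differentiableAt.differentiableWithinAt
  · intro x hx
    rw [interior_Ici] at hx
    rw [(hd x hx).deriv]
    exact hn x hx

theorem aux_ftc (f f' : ℝ → ℝ) (hf' : ContinuousOn f' (Set.Icc 0 1))
    (hd : ∀ x ∈ Set.Icc (0 : ℝ) 1, HasDerivWithinAt f (f' x) (Set.Icc (0 : ℝ) 1) x)
    (a b : ℝ) (ha : 0 ≤ a) (hab : a ≤ b) (hb : b ≤ 1) :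
    ∫ x in a..b, f' x = f b - f a := by
  have hs : Set.Icc a b ⊆ Set.Icc 0 1 := Set.Icc_subset_Icc ha hb
  apply intervalIntegral.integral_eq_sub_of_hasDerivAt_of_le hab
  · exact fun x hx => ((hd x (hs hx)).continuousWithinAt).mono hs
  · intro x hx
    exact (hd x (hs ⟨hx.1.le, hx.2.le⟩)).hasDerivAt
      (Icc_mem_nhds (by linarith [hx.1]) (by linarith [hx.2]))
  · apply ContinuousOn.intervalIntegrable_of_Icc hab (hf'.mono hs)

theorem aux_poincare (f f' : ℝ → ℝ) (M : ℝ) (hf' : ContinuousOn f' (Set.Icc 0 1))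
    (hd : ∀ x ∈ Set.Icc (0 : ℝ) 1, HasDerivWithinAt f (f' x) (Set.Icc (0 : ℝ) 1) x)
    (hM : ∫ x in (0 : ℝ)..1, f x = M) :
    ∫ x in (0 : ℝ)..1, (f x - M) ^ 2 ≤ ∫ x in (0 : ℝ)..1, f' x ^ 2 := by
  have hf : ContinuousOn f (Set.Icc 0 1) := fun x hx => (hd x hx).continuousWithinAt
  set K := ∫ x in (0 : ℝ)..1, f' x ^ 2 with hK
  have hfi : IntervalIntegrable f volume 0 1 := hf.intervalIntegrable_of_Icc zero_le_one
  have h1 : ∀ a b : ℝ, 0 ≤ a → a ≤ b → b ≤ 1 → (f b - f a) ^ 2 ≤ K := by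
    intro a b ha hab hb
    have hs : Set.Icc a b ⊆ Set.Icc 0 1 := Set.Icc_subset_Icc ha hb
    have e := aux_ftc f f' hf' hd a b ha hab hb
    set c := f b - f a
    have i1 : IntervalIntegrable f' volume a b :=
      (hf'.mono hs).intervalIntegrable_of_Icc hab
    have i2 : IntervalIntegrable (fun x => f' x ^ 2) volume a b :=
      ((hf'.mono hs).pow 2).intervalIntegrable_of_Icc hab
    have e2 : ∫ x in a..b, (f' x - c) ^ 2 =
        (∫ x in a..b, f' x ^ 2) - 2 * c * c + (b - a) * c ^ 2 := by
      have : ∀ x, (f' x - c) ^ 2 = f' x ^ 2 - 2 * c * f' x + c ^ 2 := fun x => by ring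
      simp_rw [this]
      rw [intervalIntegral.integral_add (i2.sub (i1.const_mul _)) (by simp),
        intervalIntegral.integral_sub i2 (i1.const_mul _),
        intervalIntegral.integral_const_mul, e]
      simp
    have e3 : 0 ≤ ∫ x in a..b, (f' x - c) ^ 2 :=
      intervalIntegral.integral_nonneg hab (fun x _ => sq_nonneg _)
    have e4 : ∫ x in a..b, f' x ^ 2 ≤ K := by
      apply intervalIntegral.integral_mono_interval ha hab hb
      · exact Filter.Eventually.of_forall fun x => sq_nonneg _
      · exact (hf'.pow 2).intervalIntegrable_of_Icc zero_le_one
    nlinarith [sq_nonneg c]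
  have h2 : ∀ x ∈ Set.Icc (0 : ℝ) 1, ∀ y ∈ Set.Icc (0 : ℝ) 1, |f x - f y| ≤ √K := by
    intro x hx y hy
    apply Real.abs_le_sqrt
    rcases le_total x y with h | h
    · have := h1 x y hx.1 h hy.2
      nlinarith
    · exact h1 y x hy.1 h hx.2
  have hK0 : 0 ≤ K := intervalIntegral.integral_nonneg zero_le_one (fun x _ => sq_nonneg _)
  have h3 : ∀ x ∈ Set.Icc (0 : ℝ) 1, (f x - M) ^ 2 ≤ K := by
    intro x hx
    have e : ∫ y in (0 : ℝ)..1, (f x - f y) = f x - M := by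
      rw [intervalIntegral.integral_sub (by simp) hfi, hM]
      simp
    have := intervalIntegral.norm_integral_le_of_norm_le_const (a := 0) (b := 1)
      (f := fun y => f x - f y) (C := √K) (by
        intro y hy
        rw [Set.uIoc_of_le zero_le_one] at hy
        exact h2 x hx y ⟨hy.1.le, hy.2⟩)
    rw [e] at this
    simp only [Real.norm_eq_abs, sub_zero, abs_one, mul_one] at this
    calc (f x - M) ^ 2 = |f x - M| ^ 2 := (sq_abs _).symm
      _ ≤ √K ^ 2 := by gcongr
      _ = K := Real.sq_sqrt hK0
  calc ∫ x in (0 : ℝ)..1, (f x - M) ^ 2 ≤ ∫ x in (0 : ℝ)..1, K := by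
        apply intervalIntegral.integral_mono_on zero_le_one _ (by simp) h3
        exact ((hf.sub continuousOn_const).pow 2).intervalIntegrable_of_Icc zero_le_one
    _ = K := by simp

theorem stmt_9 (α ε M : ℝ) (hε : 0 < ε)
    (ρ ρx ρt Fx : ℝ → ℝ → ℝ)
    -- continuity of ρ and of its partial derivatives on [0,1] × [0,∞)
    (hρc : ContinuousOn (fun p : ℝ × ℝ => ρ p.1 p.2) (Set.Icc 0 1 ×ˢ Set.Ici 0))
    (hρxc : ContinuousOn (fun p : ℝ × ℝ => ρx p.1 p.2) (Set.Icc 0 1 ×ˢ Set.Ici 0))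
    (hρtc : ContinuousOn (fun p : ℝ × ℝ => ρt p.1 p.2) (Set.Icc 0 1 ×ˢ Set.Ici 0))
    (hFxc : ContinuousOn (fun p : ℝ × ℝ => Fx p.1 p.2) (Set.Icc 0 1 ×ˢ Set.Ici 0))
    -- ρx is the spatial derivative, ρt the time derivative, and Fx the spatial
    -- derivative of the flux D(α,ρ)·ρx
    (hx : ∀ t ∈ Set.Ici (0 : ℝ), ∀ x ∈ Set.Icc (0 : ℝ) 1,
      HasDerivWithinAt (fun y => ρ y t) (ρx x t) (Set.Icc (0 : ℝ) 1) x)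
    (ht : ∀ t ∈ Set.Ici (0 : ℝ), ∀ x ∈ Set.Icc (0 : ℝ) 1,
      HasDerivWithinAt (fun τ => ρ x τ) (ρt x t) (Set.Ici (0 : ℝ)) t)
    (hFx : ∀ t ∈ Set.Ici (0 : ℝ), ∀ x ∈ Set.Icc (0 : ℝ) 1,
      HasDerivWithinAt (fun y => Dcoef α (ρ y t) * ρx y t) (Fx x t) (Set.Icc (0 : ℝ) 1) x)
    -- (a) the nonlinear diffusion equation
    (hPDE : ∀ t ∈ Set.Ici (0 : ℝ), ∀ x ∈ Set.Icc (0 : ℝ) 1, ρt x t = Fx x t)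
    -- (b) Neumann boundary conditions
    (hBC : ∀ t ∈ Set.Ici (0 : ℝ), ρx 0 t = 0 ∧ ρx 1 t = 0)
    -- (c) uniform parabolicity
    (hD : ∀ t ∈ Set.Ici (0 : ℝ), ∀ x ∈ Set.Icc (0 : ℝ) 1, ε ≤ Dcoef α (ρ x t))
    -- (d) initial mass
    (hM : (∫ x in (0 : ℝ)..1, ρ x 0) = M) :
    ∀ t ∈ Set.Ici (0 : ℝ),
      (∫ x in (0 : ℝ)..1, ρ x t) = M ∧
      (∫ x in (0 : ℝ)..1, (ρ x t - M) ^ 2) ≤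
        Real.exp (-2 * ε * t) * ∫ x in (0 : ℝ)..1, (ρ x 0 - M) ^ 2 := by
  have slice : ∀ h : ℝ → ℝ → ℝ,
      ContinuousOn (fun p : ℝ × ℝ => h p.1 p.2) (Set.Icc 0 1 ×ˢ Set.Ici 0) →
      ∀ t, 0 ≤ t → ContinuousOn (fun x => h x t) (Set.Icc 0 1) := by
    intro h hh t ht
    exact hh.comp (f := fun x : ℝ => (x, t)) (by fun_prop) (fun x hx => ⟨hx, ht⟩)
  have mass : ∀ t, 0 ≤ t → (∫ x in (0 : ℝ)..1, ρ x t) = M := by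
    obtain ⟨c, d⟩ := aux_param ρ ρt hρc hρtc ht
    have z : ∀ t, 0 < t → (∫ x in (0 : ℝ)..1, ρt x t) = 0 := by
      intro t h0
      have e : (∫ x in (0 : ℝ)..1, ρt x t) = ∫ x in (0 : ℝ)..1, Fx x t := by
        apply intervalIntegral.integral_congr
        intro x hx
        rw [Set.uIcc_of_le zero_le_one] at hx
        exact hPDE t h0.le x hx
      rw [e, aux_ftc _ _ (slice Fx hFxc t h0.le) (hFx t h0.le) 0 1 le_rfl zero_le_one le_rfl,
        (hBC t h0.le).1, (hBC t h0.le).2]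
      simp
    intro t h0
    have a1 := aux_anti _ _ c d (fun t h => (z t h).le) t h0
    have a2 := aux_anti _ _ c.neg (fun t h => (d t h).neg)
      (fun t h => by simp [z t h]) t h0
    simp only [Pi.neg_apply] at a2
    linarith
  intro t h0
  refine ⟨mass t h0, ?_⟩
  have hgc : ContinuousOn (fun p : ℝ × ℝ => (ρ p.1 p.2 - M) ^ 2) (Set.Icc 0 1 ×ˢ Set.Ici 0) :=
    (hρc.sub continuousOn_const).pow 2
  have hgtc : ContinuousOn (fun p : ℝ × ℝ => 2 * (ρ p.1 p.2 - M) * ρt p.1 p.2)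
      (Set.Icc 0 1 ×ˢ Set.Ici 0) :=
    (continuousOn_const.mul (hρc.sub continuousOn_const)).mul hρtc
  obtain ⟨c, d⟩ := aux_param (fun x t => (ρ x t - M) ^ 2) (fun x t => 2 * (ρ x t - M) * ρt x t)
    hgc hgtc (by
      intro t h0 x hx
      have := ((ht t h0 x hx).sub_const M).pow 2
      refine this.congr_deriv ?_
      norm_num)
  have dis : ∀ t, 0 < t → (∫ x in (0 : ℝ)..1, 2 * (ρ x t - M) * ρt x t) ≤
      -2 * ε * ∫ x in (0 : ℝ)..1, (ρ x t - M) ^ 2 := by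
    intro t h0
    have cρ := slice ρ hρc t h0.le
    have cρx := slice ρx hρxc t h0.le
    have cFx := slice Fx hFxc t h0.le
    have cD : ContinuousOn (fun x => Dcoef α (ρ x t)) (Set.Icc 0 1) := by
      unfold Dcoef
      fun_prop
    have poin := aux_poincare (fun x => ρ x t) (fun x => ρx x t) M cρx (hx t h0.le)
      (mass t h0.le)
    have c1 : ContinuousOn (fun x => ρx x t * (Dcoef α (ρ x t) * ρx x t)) (Set.Icc 0 1) :=
      cρx.mul (cD.mul cρx)
    have c2 : ContinuousOn (fun x => (ρ x t - M) * Fx x t) (Set.Icc 0 1) :=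
      (cρ.sub continuousOn_const).mul cFx
    have parts := aux_ftc (fun x => (ρ x t - M) * (Dcoef α (ρ x t) * ρx x t))
      (fun x => ρx x t * (Dcoef α (ρ x t) * ρx x t) + (ρ x t - M) * Fx x t)
      (c1.add c2)
      (fun x hxx => ((hx t h0.le x hxx).sub_const M).mul (hFx t h0.le x hxx))
      0 1 le_rfl zero_le_one le_rfl
    rw [intervalIntegral.integral_add (c1.intervalIntegrable_of_Icc zero_le_one)
      (c2.intervalIntegrable_of_Icc zero_le_one)] at parts
    simp only [(hBC t h0.le).1, (hBC t h0.le).2, mul_zero, sub_zero] at parts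
    have e : (∫ x in (0 : ℝ)..1, 2 * (ρ x t - M) * ρt x t) =
        2 * ∫ x in (0 : ℝ)..1, (ρ x t - M) * Fx x t := by
      rw [← intervalIntegral.integral_const_mul]
      apply intervalIntegral.integral_congr
      intro x hx
      rw [Set.uIcc_of_le zero_le_one] at hx
      simp only [hPDE t h0.le x hx]
      ring
    have low : ε * (∫ x in (0 : ℝ)..1, ρx x t ^ 2) ≤
        ∫ x in (0 : ℝ)..1, ρx x t * (Dcoef α (ρ x t) * ρx x t) := by
      rw [← intervalIntegral.integral_const_mul]
      apply intervalIntegral.integral_mono_on zero_le_one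
      · exact (continuousOn_const.mul (cρx.pow 2)).intervalIntegrable_of_Icc zero_le_one
      · exact c1.intervalIntegrable_of_Icc zero_le_one
      · intro x hx
        nlinarith [mul_le_mul_of_nonneg_right (hD t h0.le x hx) (sq_nonneg (ρx x t))]
    have := mul_le_mul_of_nonneg_left poin hε.le
    rw [e]
    linarith
  have dE : ∀ t : ℝ, HasDerivAt (fun t : ℝ => Real.exp (2 * ε * t))
      (Real.exp (2 * ε * t) * (2 * ε)) t := by
    intro t
    have := ((hasDerivAt_id t).const_mul (2 * ε)).exp
    simpa using this
  have fin := aux_anti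
    (fun t => Real.exp (2 * ε * t) * ∫ x in (0 : ℝ)..1, (ρ x t - M) ^ 2) _
    (ContinuousOn.mul (by fun_prop) c)
    (fun t h => (dE t).mul (d t h))
    (fun t h => by
      have := mul_le_mul_of_nonneg_left (dis t h) (Real.exp_pos (2 * ε * t)).le
      linarith) t h0
  simp only [mul_zero, Real.exp_zero, one_mul] at fin
  have e1 : Real.exp (-2 * ε * t) * Real.exp (2 * ε * t) = 1 := by
    rw [← Real.exp_add]
    simp
  calc (∫ x in (0 : ℝ)..1, (ρ x t - M) ^ 2)
      = Real.exp (-2 * ε * t) * (Real.exp (2 * ε * t) * ∫ x in (0 : ℝ)..1, (ρ x t - M) ^ 2) := by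
        rw [← mul_assoc, e1, one_mul]
    _ ≤ _ := mul_le_mul_of_nonneg_left fin (Real.exp_pos _).le
end

section
/- Let α ∈ ℝ, ρ₁ ∈ ℝ, ε > 0, 0 < s_max < 1, T > 0, and let s : [0,T] → (0,1) be continuously differentiable with s(t) ≤ s_max for all t. Let Q = {(x,t) : t ∈ [0,T], 0 ≤ x ≤ s(t)}, and suppose ρ is continuous on Q together with ∂ₓρ, ∂ₜρ and ∂ₓ(D(α,ρ)∂ₓρ), and: (a) ∂ₜρ = ∂ₓ(D(α,ρ)∂ₓρ) on Q; (b) ∂ₓρ(0,t) = 0 and ρ(s(t),t) = ρ₁ for all t ∈ [0,T]; (c) D(α,ρ(x,t)) ≥ ε on Q. Then for every t ∈ [0,T], ∫₀^{s(t)} (ρ(x,t) − ρ₁)² dx ≤ e^{−εt/s_max²} ∫₀^{s(0)} (ρ(x,0) − ρ₁)² dx. -/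
open MeasureTheory

lemma energy_ineq (c ε : ℝ) (hc : 0 < c) (hε : 0 < ε) (u u' F F' D : ℝ → ℝ)
    (hu : ∀ x ∈ Set.Icc 0 c, HasDerivWithinAt u (u' x) (Set.Icc 0 c) x)
    (hF : ∀ x ∈ Set.Icc 0 c, HasDerivWithinAt F (F' x) (Set.Icc 0 c) x)
    (hu'c : ContinuousOn u' (Set.Icc 0 c)) (hF'c : ContinuousOn F' (Set.Icc 0 c))
    (hFD : ∀ x ∈ Set.Icc 0 c, F x = D x * u' x) (hD : ∀ x ∈ Set.Icc 0 c, ε ≤ D x)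
    (huc : u c = 0) (hu0 : u' 0 = 0) :
    (∫ x in (0:ℝ)..c, 2 * u x * F' x) ≤ -(ε / c ^ 2) * ∫ x in (0:ℝ)..c, u x ^ 2 := by
  have huC : ContinuousOn u (Set.Icc 0 c) := fun x hx => (hu x hx).continuousWithinAt
  have hFC : ContinuousOn F (Set.Icc 0 c) := fun x hx => (hF x hx).continuousWithinAt
  have hint : ∀ g : ℝ → ℝ, ContinuousOn g (Set.Icc 0 c) → IntervalIntegrable g volume 0 c := by
    intro g hg
    apply ContinuousOn.intervalIntegrable
    rwa [Set.uIcc_of_le hc.le]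
  set P : ℝ → ℝ := fun x => 2 * (u x * F x) + (ε / c ^ 2) * ((x + x ^ 3 / (3 * c ^ 2)) * u x ^ 2)
    with hP
  set P' : ℝ → ℝ := fun x => 2 * (u' x * F x + u x * F' x) +
    (ε / c ^ 2) * ((1 + 3 * x ^ 2 / (3 * c ^ 2)) * u x ^ 2
      + (x + x ^ 3 / (3 * c ^ 2)) * (2 * u x * u' x)) with hP'
  have hPd : ∀ x ∈ Set.Icc 0 c, HasDerivWithinAt P (P' x) (Set.Icc 0 c) x := by
    intro x hx
    have h1 := ((hu x hx).mul (hF x hx)).const_mul 2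
    have h2 : HasDerivWithinAt (fun x : ℝ => x + x ^ 3 / (3 * c ^ 2))
        (1 + 3 * x ^ 2 / (3 * c ^ 2)) (Set.Icc 0 c) x := by
      have := ((hasDerivAt_id' x).add (((hasDerivAt_pow 3 x)).div_const (3 * c ^ 2)))
      refine this.hasDerivWithinAt.congr_deriv ?_
      norm_num
    have h3 := (h2.mul ((hu x hx).pow 2)).const_mul (ε / c ^ 2)
    refine (h1.add h3).congr_deriv ?_
    simp only [hP', Nat.cast_ofNat, Pi.pow_apply]
    ring
  have hP'c : ContinuousOn P' (Set.Icc 0 c) := by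
    simp only [hP']
    fun_prop
  have hFTC : (∫ x in (0:ℝ)..c, P' x) = 0 := by
    rw [intervalIntegral.integral_eq_sub_of_hasDerivAt_of_le hc.le
      (fun x hx => (hPd x hx).continuousWithinAt)
      (fun x hx => (hPd x (Set.Ioo_subset_Icc_self hx)).hasDerivAt (Icc_mem_nhds hx.1 hx.2))
      (hint _ hP'c)]
    have : F 0 = 0 := by rw [hFD 0 ⟨le_rfl, hc.le⟩, hu0, mul_zero]
    simp [hP, huc, this]
  have hle : (∫ x in (0:ℝ)..c, (2 * u x * F' x + (ε / c ^ 2) * u x ^ 2)) ≤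
      ∫ x in (0:ℝ)..c, P' x := by
    apply intervalIntegral.integral_mono_on hc.le (hint _ (by fun_prop)) (hint _ hP'c)
    intro x hx
    simp only [hP', hFD x hx]
    have hDx := hD x hx
    obtain ⟨z, hz⟩ : ∃ z, z = x / c := ⟨_, rfl⟩
    have hxz : x = z * c := by rw [hz]; field_simp
    have hz0 : 0 ≤ z := by rw [hz]; exact div_nonneg hx.1 hc.le
    have hz1 : z ≤ 1 := by rw [hz]; exact (div_le_one hc).2 hx.2
    obtain ⟨a, ha⟩ : ∃ a, a = u x / c := ⟨_, rfl⟩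
    have hau : u x = a * c := by rw [ha]; field_simp
    have e1 : 2 * (u' x * (D x * u' x) + u x * F' x) +
      (ε / c ^ 2) * ((1 + 3 * x ^ 2 / (3 * c ^ 2)) * u x ^ 2
      + (x + x ^ 3 / (3 * c ^ 2)) * (2 * u x * u' x)) - (2 * u x * F' x + (ε / c ^ 2) * u x ^ 2)
      = 2 * (D x - ε) * u' x ^ 2 + ε * (2 * u' x ^ 2 + z ^ 2 * a ^ 2
        + 2 * (z + z ^ 3 / 3) * a * u' x) := by
      rw [hau, hxz]
      field_simp
      ring
    have e2 : 0 ≤ 2 * u' x ^ 2 + z ^ 2 * a ^ 2 + 2 * (z + z ^ 3 / 3) * a * u' x := by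
      have hq : z ^ 2 ≤ 1 := by nlinarith
      have hk : (1 + z ^ 2 / 3) ^ 2 ≤ 2 := by nlinarith [sq_nonneg z]
      have : 2 * u' x ^ 2 + z ^ 2 * a ^ 2 + 2 * (z + z ^ 3 / 3) * a * u' x
        = (z * a + (1 + z ^ 2 / 3) * u' x) ^ 2 + (2 - (1 + z ^ 2 / 3) ^ 2) * u' x ^ 2 := by ring
      rw [this]
      have := mul_nonneg (sub_nonneg.2 hk) (sq_nonneg (u' x))
      positivity
    have e3 := mul_nonneg hε.le e2
    have e4 := mul_nonneg (sub_nonneg.2 hDx) (sq_nonneg (u' x))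
    linarith
  rw [intervalIntegral.integral_add (hint _ (by fun_prop)) (hint _ (by fun_prop)),
    intervalIntegral.integral_const_mul, hFTC] at hle
  linarith

lemma deriv_ind (T ρ₁ x t : ℝ) (s : ℝ → ℝ) (ρ ρt : ℝ → ℝ → ℝ)
    (hs : ContinuousWithinAt s (Set.Icc 0 T) t)
    (hb : ρ (s t) t = ρ₁)
    (h : x ≤ s t → HasDerivWithinAt (fun τ => ρ x τ) (ρt x t) (Set.Icc (0 : ℝ) T) t) :
    HasDerivWithinAt (fun τ => Set.indicator {y | y ≤ s τ} (fun y => (ρ y τ - ρ₁) ^ 2) x)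
      (Set.indicator {y | y ≤ s t} (fun y => 2 * (ρ y t - ρ₁) * ρt y t) x)
      (Set.Icc 0 T) t := by
  have h2 : x ≤ s t → HasDerivWithinAt (fun τ => (ρ x τ - ρ₁) ^ 2) (2 * (ρ x t - ρ₁) * ρt x t)
      (Set.Icc (0 : ℝ) T) t := by
    intro hx
    refine (((h hx).sub_const ρ₁).pow 2).congr_deriv ?_
    simp
  rcases lt_trichotomy x (s t) with hx | hx | hx
  · have hev : ∀ᶠ τ in nhdsWithin t (Set.Icc 0 T), x < s τ := hs.eventually (lt_mem_nhds hx)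
    rw [Set.indicator_of_mem (by exact hx.le)]
    refine (h2 hx.le).congr_of_eventuallyEq ?_ ?_
    · filter_upwards [hev] with τ hτ
      exact Set.indicator_of_mem (by exact hτ.le) _
    · exact Set.indicator_of_mem (by exact hx.le) _
  · have h3 := h2 hx.le
    have hz : ρ x t - ρ₁ = 0 := by rw [hx, hb, sub_self]
    rw [Set.indicator_of_mem (by exact hx.le)]
    rw [hz, mul_zero, zero_mul] at h3 ⊢
    rw [hasDerivWithinAt_iff_isLittleO] at h3 ⊢
    refine Asymptotics.IsBigO.trans_isLittleO ?_ h3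
    apply Asymptotics.IsBigO.of_norm_le
    intro τ
    have h0 : Set.indicator {y | y ≤ s t} (fun y => (ρ y t - ρ₁) ^ 2) x = 0 := by
      rw [Set.indicator_of_mem (by exact hx.le), hz]; norm_num
    simp only [h0, hz, smul_zero, sub_zero, ne_eq, OfNat.ofNat_ne_zero, not_false_eq_true, zero_pow]
    refine (norm_indicator_le_norm_self (fun y => (ρ y τ - ρ₁) ^ 2) x).trans (le_of_eq ?_)
    simp
  · have hev : ∀ᶠ τ in nhdsWithin t (Set.Icc 0 T), s τ < x := hs.eventually (gt_mem_nhds hx)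
    rw [Set.indicator_of_notMem (by simpa using hx)]
    refine (hasDerivWithinAt_const t _ (0:ℝ)).congr_of_eventuallyEq ?_ ?_
    · filter_upwards [hev] with τ hτ
      exact Set.indicator_of_notMem (by simpa using hτ) _
    · exact Set.indicator_of_notMem (by simpa using hx) _

lemma compact_Q (T : ℝ) (s : ℝ → ℝ) (hs : ContinuousOn s (Set.Icc 0 T))
    (hpos : ∀ t ∈ Set.Icc (0 : ℝ) T, 0 < s t) :
    IsCompact {p : ℝ × ℝ | p.2 ∈ Set.Icc (0 : ℝ) T ∧ p.1 ∈ Set.Icc 0 (s p.2)} := by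
  have h : {p : ℝ × ℝ | p.2 ∈ Set.Icc (0 : ℝ) T ∧ p.1 ∈ Set.Icc 0 (s p.2)} =
      (fun q : ℝ × ℝ => (q.1 * s q.2, q.2)) '' (Set.Icc (0:ℝ) 1 ×ˢ Set.Icc (0:ℝ) T) := by
    ext ⟨x, t⟩
    simp only [Set.mem_ofPred_eq, Set.mem_image, Set.mem_prod, Prod.mk.injEq, Prod.exists]
    constructor
    · rintro ⟨h1, h2⟩
      have := hpos t h1
      exact ⟨x / s t, t, ⟨⟨div_nonneg h2.1 this.le, (div_le_one this).2 h2.2⟩, h1⟩,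
        by field_simp, rfl⟩
    · rintro ⟨y, t', ⟨h1, h2⟩, h3, rfl⟩
      have := hpos t' h2
      refine ⟨h2, ?_⟩
      rw [← h3]
      exact ⟨mul_nonneg h1.1 this.le, by nlinarith [h1.2]⟩
  rw [h]
  apply (isCompact_Icc.prod isCompact_Icc).image_of_continuousOn
  have : ContinuousOn (fun q : ℝ × ℝ => s q.2) (Set.Icc (0:ℝ) 1 ×ˢ Set.Icc (0:ℝ) T) :=
    hs.comp continuousOn_snd (fun q hq => hq.2)
  exact (continuousOn_fst.mul this).prodMk continuousOn_snd

theorem stmt_10 (α ρ₁ ε sMax T : ℝ) (hε : 0 < ε)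
    (hsMax0 : 0 < sMax) (hsMax1 : sMax < 1) (hT : 0 < T)
    (s s' : ℝ → ℝ)
    (hsC1 : ∀ t ∈ Set.Icc (0 : ℝ) T, HasDerivWithinAt s (s' t) (Set.Icc (0 : ℝ) T) t)
    (hs'c : ContinuousOn s' (Set.Icc (0 : ℝ) T))
    (hsin : ∀ t ∈ Set.Icc (0 : ℝ) T, s t ∈ Set.Ioo (0 : ℝ) 1)
    (hsmax : ∀ t ∈ Set.Icc (0 : ℝ) T, s t ≤ sMax)
    (ρ ρx ρt Fx : ℝ → ℝ → ℝ)
    -- Q = {(x,t) : t ∈ [0,T], 0 ≤ x ≤ s(t)}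
    (Q : Set (ℝ × ℝ)) (hQ : Q = {p : ℝ × ℝ | p.2 ∈ Set.Icc (0 : ℝ) T ∧ p.1 ∈ Set.Icc 0 (s p.2)})
    -- continuity of ρ and of its partial derivatives on Q
    (hρc : ContinuousOn (fun p : ℝ × ℝ => ρ p.1 p.2) Q)
    (hρxc : ContinuousOn (fun p : ℝ × ℝ => ρx p.1 p.2) Q)
    (hρtc : ContinuousOn (fun p : ℝ × ℝ => ρt p.1 p.2) Q)
    (hFxc : ContinuousOn (fun p : ℝ × ℝ => Fx p.1 p.2) Q)
    (hx : ∀ t ∈ Set.Icc (0 : ℝ) T, ∀ x ∈ Set.Icc 0 (s t),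
      HasDerivWithinAt (fun y => ρ y t) (ρx x t) (Set.Icc 0 (s t)) x)
    (ht : ∀ t ∈ Set.Icc (0 : ℝ) T, ∀ x ∈ Set.Icc 0 (s t),
      HasDerivWithinAt (fun τ => ρ x τ) (ρt x t) (Set.Icc (0 : ℝ) T) t)
    (hFx : ∀ t ∈ Set.Icc (0 : ℝ) T, ∀ x ∈ Set.Icc 0 (s t),
      HasDerivWithinAt (fun y => Dcoef α (ρ y t) * ρx y t) (Fx x t) (Set.Icc 0 (s t)) x)
    -- (a) the nonlinear diffusion equation on Q
    (hPDE : ∀ t ∈ Set.Icc (0 : ℝ) T, ∀ x ∈ Set.Icc 0 (s t), ρt x t = Fx x t)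
    -- (b) Neumann condition at x = 0 and Dirichlet condition at the moving boundary
    (hBC : ∀ t ∈ Set.Icc (0 : ℝ) T, ρx 0 t = 0 ∧ ρ (s t) t = ρ₁)
    -- (c) uniform parabolicity on Q
    (hD : ∀ t ∈ Set.Icc (0 : ℝ) T, ∀ x ∈ Set.Icc 0 (s t), ε ≤ Dcoef α (ρ x t)) :
    ∀ t ∈ Set.Icc (0 : ℝ) T,
      (∫ x in (0 : ℝ)..(s t), (ρ x t - ρ₁) ^ 2) ≤
        Real.exp (-ε * t / sMax ^ 2) * ∫ x in (0 : ℝ)..(s 0), (ρ x 0 - ρ₁) ^ 2 := by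
  have hsc : ContinuousOn s (Set.Icc 0 T) := fun t h => (hsC1 t h).continuousWithinAt
  have hQc : IsCompact Q := by
    rw [hQ]; exact compact_Q T s hsc (fun t h => (hsin t h).1)
  have hmem : ∀ t ∈ Set.Icc (0 : ℝ) T, ∀ x ∈ Set.Icc 0 (s t), (x, t) ∈ Q := by
    intro t h x hx; rw [hQ]; exact ⟨h, hx⟩
  have hslice : ∀ f : ℝ → ℝ → ℝ, ContinuousOn (fun p : ℝ × ℝ => f p.1 p.2) Q →
      ∀ t ∈ Set.Icc (0 : ℝ) T, ContinuousOn (fun x => f x t) (Set.Icc 0 (s t)) := by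
    intro f hf t h
    exact hf.comp (f := fun x : ℝ => (x, t)) (by fun_prop) (fun x hx => hmem t h x hx)
  set w : ℝ → ℝ → ℝ := fun t x =>
    Set.indicator {y | y ≤ s t} (fun y => (ρ y t - ρ₁) ^ 2) x with hw
  set g : ℝ → ℝ → ℝ := fun t x =>
    Set.indicator {y | y ≤ s t} (fun y => 2 * (ρ y t - ρ₁) * ρt y t) x with hg
  have hind : ∀ f : ℝ → ℝ, ∀ t ∈ Set.Icc (0 : ℝ) T,
      (∫ x in (0:ℝ)..1, Set.indicator {y | y ≤ s t} f x) = ∫ x in (0:ℝ)..(s t), f x := by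
    intro f t h
    exact intervalIntegral.integral_indicator ⟨(hsin t h).1.le, (hsin t h).2.le⟩
  have hmeas : ∀ f : ℝ → ℝ, ∀ t ∈ Set.Icc (0 : ℝ) T, ContinuousOn f (Set.Icc 0 (s t)) →
      AEStronglyMeasurable (Set.indicator {y | y ≤ s t} f)
        (volume.restrict (Set.uIoc (0:ℝ) 1)) := by
    intro f t h hf
    have hms : MeasurableSet {y | y ≤ s t} := measurableSet_Iic
    rw [aestronglyMeasurable_indicator_iff hms, Measure.restrict_restrict hms]
    refine (hf.aestronglyMeasurable (μ := volume) measurableSet_Icc).mono_measure ?_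
    apply Measure.restrict_mono _ le_rfl
    rintro y ⟨h1, h2⟩
    rw [Set.uIoc_of_le zero_le_one] at h2
    exact ⟨h2.1.le, h1⟩
  have hwm : ∀ t ∈ Set.Icc (0 : ℝ) T, AEStronglyMeasurable (w t)
      (volume.restrict (Set.uIoc (0:ℝ) 1)) := by
    intro t h
    have := hslice ρ hρc t h
    exact hmeas (fun y => (ρ y t - ρ₁) ^ 2) t h (by fun_prop)
  have hgm : ∀ t ∈ Set.Icc (0 : ℝ) T, AEStronglyMeasurable (g t)
      (volume.restrict (Set.uIoc (0:ℝ) 1)) := by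
    intro t h
    have h1 := hslice ρ hρc t h
    have h2 := hslice ρt hρtc t h
    exact hmeas (fun y => 2 * (ρ y t - ρ₁) * ρt y t) t h (by fun_prop)
  have hbd : ∀ f : ℝ → ℝ → ℝ, ContinuousOn (fun p : ℝ × ℝ => f p.1 p.2) Q →
      ∃ C : ℝ, ∀ t ∈ Set.Icc (0 : ℝ) T, ∀ x ∈ Set.uIoc (0:ℝ) 1,
        ‖Set.indicator {y | y ≤ s t} (fun y => f y t) x‖ ≤ C := by
    intro f hf
    obtain ⟨C, hC⟩ := hQc.exists_bound_of_continuousOn hf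
    refine ⟨max C 0, fun t h x hx => ?_⟩
    rw [Set.uIoc_of_le zero_le_one] at hx
    by_cases hxs : x ≤ s t
    · rw [Set.indicator_of_mem (by exact hxs)]
      exact (hC (x, t) (hmem t h x ⟨hx.1.le, hxs⟩)).trans (le_max_left _ _)
    · rw [Set.indicator_of_notMem (by exact hxs), norm_zero]
      exact le_max_right _ _
  obtain ⟨Cw, hCw⟩ := hbd (fun x t => (ρ x t - ρ₁) ^ 2) (by fun_prop)
  obtain ⟨Cg, hCg⟩ := hbd (fun x t => 2 * (ρ x t - ρ₁) * ρt x t) (by fun_prop)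
  have hwd : ∀ t ∈ Set.Icc (0 : ℝ) T, ∀ x ∈ Set.uIoc (0:ℝ) 1,
      HasDerivWithinAt (fun τ => w τ x) (g t x) (Set.Icc 0 T) t := by
    intro t h x hx
    rw [Set.uIoc_of_le zero_le_one] at hx
    exact deriv_ind T ρ₁ x t s ρ ρt (hsc t h) (hBC t h).2 (fun hxs => ht t h x ⟨hx.1.le, hxs⟩)
  set E : ℝ → ℝ := fun t => ∫ x in (0:ℝ)..1, w t x with hE
  have hEc : ContinuousOn E (Set.Icc 0 T) := by
    intro t h
    apply intervalIntegral.continuousWithinAt_of_dominated_interval (bound := fun _ => Cw)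
    · filter_upwards [self_mem_nhdsWithin] with τ hτ using hwm τ hτ
    · filter_upwards [self_mem_nhdsWithin] with τ hτ
      exact Filter.Eventually.of_forall (fun x hx => hCw τ hτ x hx)
    · exact intervalIntegrable_const
    · exact Filter.Eventually.of_forall (fun x hx => (hwd t h x hx).continuousWithinAt)
  have hwi : ∀ t ∈ Set.Icc (0 : ℝ) T, IntervalIntegrable (w t) volume 0 1 := by
    intro t h
    refine (intervalIntegrable_const (c := Cw)).mono_fun (hwm t h) ?_
    filter_upwards [ae_restrict_mem measurableSet_uIoc] with x hx
    exact (hCw t h x hx).trans (le_abs_self _)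
  have hEd : ∀ t ∈ Set.Ioo (0 : ℝ) T, HasDerivAt E (∫ x in (0:ℝ)..1, g t x) t := by
    intro t h
    have hI := Set.Ioo_subset_Icc_self h
    refine (intervalIntegral.hasDerivAt_integral_of_dominated_loc_of_deriv_le
      (F := w) (F' := g) (bound := fun _ => Cg) (Ioo_mem_nhds h.1 h.2)
      ?_ (hwi t hI) (hgm t hI) ?_ intervalIntegrable_const ?_).2
    · filter_upwards [Ioo_mem_nhds h.1 h.2] with τ hτ using hwm τ (Set.Ioo_subset_Icc_self hτ)
    · exact Filter.Eventually.of_forall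
        (fun x hx τ hτ => hCg τ (Set.Ioo_subset_Icc_self hτ) x hx)
    · exact Filter.Eventually.of_forall (fun x hx τ hτ =>
        (hwd τ (Set.Ioo_subset_Icc_self hτ) x hx).hasDerivAt (Icc_mem_nhds hτ.1 hτ.2))
  have hEeq : ∀ t ∈ Set.Icc (0 : ℝ) T, E t = ∫ x in (0 : ℝ)..(s t), (ρ x t - ρ₁) ^ 2 :=
    fun t h => hind _ t h
  have hineq : ∀ t ∈ Set.Icc (0 : ℝ) T, (∫ x in (0:ℝ)..1, g t x) ≤ -(ε / sMax ^ 2) * E t := by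
    intro t h
    have hs0 := (hsin t h).1
    have e1 : (∫ x in (0:ℝ)..1, g t x) = ∫ x in (0:ℝ)..(s t), 2 * (ρ x t - ρ₁) * Fx x t := by
      rw [hg, hind _ t h]
      apply intervalIntegral.integral_congr
      intro x hx
      rw [Set.uIcc_of_le hs0.le] at hx
      simp only [hPDE t h x hx]
    have e2 := energy_ineq (s t) ε hs0 hε (fun x => ρ x t - ρ₁) (fun x => ρx x t)
      (fun y => Dcoef α (ρ y t) * ρx y t) (fun x => Fx x t) (fun y => Dcoef α (ρ y t))
      (fun x hx' => (hx t h x hx').sub_const ρ₁) (hFx t h) (hslice ρx hρxc t h)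
      (hslice Fx hFxc t h) (fun _ _ => rfl) (hD t h) (by simp [(hBC t h).2]) (hBC t h).1
    rw [e1]
    refine e2.trans ?_
    rw [← hEeq t h]
    have hE0 : 0 ≤ E t := by
      rw [hEeq t h]
      exact intervalIntegral.integral_nonneg hs0.le (fun x _ => sq_nonneg _)
    apply mul_le_mul_of_nonneg_right _ hE0
    apply neg_le_neg
    have := hsmax t h
    gcongr
  set k := ε / sMax ^ 2 with hk
  have hanti : AntitoneOn (fun t => Real.exp (k * t) * E t) (Set.Icc 0 T) := by
    have hd : ∀ t ∈ Set.Ioo (0 : ℝ) T, HasDerivAt (fun t => Real.exp (k * t) * E t)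
        (Real.exp (k * t) * k * E t + Real.exp (k * t) * ∫ x in (0:ℝ)..1, g t x) t := by
      intro t h
      have h1 : HasDerivAt (fun t => Real.exp (k * t)) (Real.exp (k * t) * k) t := by
        simpa using ((hasDerivAt_id' t).const_mul k).exp
      exact h1.mul (hEd t h)
    apply antitoneOn_of_deriv_nonpos (convex_Icc 0 T)
    · fun_prop
    · rw [interior_Icc]
      exact fun t h => (hd t h).differentiableAt.differentiableWithinAt
    · rw [interior_Icc]
      intro t h
      rw [(hd t h).deriv]
      have h1 := hineq t (Set.Ioo_subset_Icc_self h)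
      have h2 := mul_le_mul_of_nonneg_left h1 (Real.exp_pos (k * t)).le
      linarith
  intro t h
  have h0 : (0:ℝ) ∈ Set.Icc 0 T := ⟨le_rfl, hT.le⟩
  have h1 := hanti h0 h h.1
  simp only [mul_zero, Real.exp_zero, one_mul] at h1
  rw [← hEeq t h, ← hEeq 0 h0]
  have h2 := mul_le_mul_of_nonneg_left h1 (Real.exp_pos (-(k * t))).le
  rw [← mul_assoc, ← Real.exp_add, neg_add_cancel, Real.exp_zero, one_mul] at h2
  have h3 : -ε * t / sMax ^ 2 = -(k * t) := by rw [hk]; ring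
  rw [h3]
  exact h2
end

section
/- Let ρ₁ < ρ₂ and M be real numbers and set s* = (ρ₂ − M)/(ρ₂ − ρ₁). For every s ∈ [0,1] and every square-integrable ρ : [0,1] → ℝ with ∫₀¹ ρ(x) dx = M, one has (ρ₂ − ρ₁)·|s − s*| ≤ (∫₀ˢ (ρ(x) − ρ₁)² dx)^{1/2} + (∫ₛ¹ (ρ(x) − ρ₂)² dx)^{1/2}. -/
open MeasureTheory

lemma aux_cs (a b c : ℝ) (hab : a ≤ b) (hb : b - a ≤ 1) (ρ : ℝ → ℝ)
    (h1 : IntervalIntegrable ρ volume a b)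
    (h2 : IntervalIntegrable (fun x => (ρ x) ^ 2) volume a b) :
    |(∫ x in a..b, ρ x) - c * (b - a)| ≤ Real.sqrt (∫ x in a..b, (ρ x - c) ^ 2) := by
  have key : ∀ d : ℝ, (∫ x in a..b, (ρ x - d) ^ 2)
      = (∫ x in a..b, (ρ x) ^ 2) - 2 * d * (∫ x in a..b, ρ x) + d ^ 2 * (b - a) := by
    intro d
    have e : (fun x => (ρ x - d) ^ 2) = fun x => ((ρ x) ^ 2 - 2 * d * ρ x) + d ^ 2 := by
      funext x; ring
    rw [e, intervalIntegral.integral_add (h2.sub (h1.const_mul _)) (by simp),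
      intervalIntegral.integral_sub h2 (h1.const_mul _),
      intervalIntegral.integral_const_mul, intervalIntegral.integral_const]
    simp only [smul_eq_mul]; ring
  apply Real.le_sqrt_of_sq_le
  rw [sq_abs]
  set I := (∫ x in a..b, ρ x) - c * (b - a) with hI
  have h0 : 0 ≤ ∫ x in a..b, (ρ x - (c + I)) ^ 2 :=
    intervalIntegral.integral_nonneg hab (fun x _ => sq_nonneg _)
  rw [key] at h0 ⊢
  have hJ : (∫ x in a..b, ρ x) = I + c * (b - a) := by rw [hI]; ring
  rw [hJ] at h0 ⊢
  nlinarith [mul_nonneg (sq_nonneg I) (sub_nonneg.2 hb)]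

theorem stmt_11 (ρ₁ ρ₂ M : ℝ) (h12 : ρ₁ < ρ₂) (sStar : ℝ)
    (hsStar : sStar = (ρ₂ - M) / (ρ₂ - ρ₁))
    (s : ℝ) (hs : s ∈ Set.Icc (0 : ℝ) 1)
    (ρ : ℝ → ℝ)
    (hmeas : AEStronglyMeasurable ρ (volume.restrict (Set.Icc (0 : ℝ) 1)))
    (hsq : IntegrableOn (fun x => (ρ x) ^ 2) (Set.Icc (0 : ℝ) 1))
    (hM : (∫ x in (0 : ℝ)..1, ρ x) = M) :
    (ρ₂ - ρ₁) * |s - sStar| ≤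
      Real.sqrt (∫ x in (0 : ℝ)..s, (ρ x - ρ₁) ^ 2) +
      Real.sqrt (∫ x in s..(1 : ℝ), (ρ x - ρ₂) ^ 2) := by
  obtain ⟨hs0, hs1⟩ := hs
  have hint : IntegrableOn ρ (Set.Icc (0 : ℝ) 1) :=
    ((memLp_two_iff_integrable_sq hmeas).2 hsq).integrable (by norm_num)
  have sub : ∀ f : ℝ → ℝ, IntegrableOn f (Set.Icc (0 : ℝ) 1) →
      IntervalIntegrable f volume 0 s ∧ IntervalIntegrable f volume s 1 := by
    intro f hf
    constructor
    · rw [intervalIntegrable_iff_integrableOn_Icc_of_le hs0]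
      exact hf.mono_set (Set.Icc_subset_Icc le_rfl hs1)
    · rw [intervalIntegrable_iff_integrableOn_Icc_of_le hs1]
      exact hf.mono_set (Set.Icc_subset_Icc hs0 le_rfl)
  obtain ⟨i1, i2⟩ := sub _ hint
  obtain ⟨j1, j2⟩ := sub _ hsq
  have A := aux_cs 0 s ρ₁ hs0 (by linarith) ρ i1 j1
  have B := aux_cs s 1 ρ₂ hs1 (by linarith) ρ i2 j2
  have hsum := intervalIntegral.integral_add_adjacent_intervals i1 i2
  rw [hM] at hsum
  have hpos : 0 < ρ₂ - ρ₁ := sub_pos.2 h12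
  have e : (ρ₂ - ρ₁) * |s - sStar| = |((∫ x in (0 : ℝ)..s, ρ x) - ρ₁ * (s - 0)) +
      ((∫ x in s..(1 : ℝ), ρ x) - ρ₂ * (1 - s))| := by
    have hm : (ρ₂ - ρ₁) * sStar = ρ₂ - M := by rw [hsStar]; field_simp
    rw [← abs_of_pos hpos, ← abs_mul]
    congr 1
    linear_combination -hm - hsum
  rw [e]
  exact (abs_add_le _ _).trans (add_le_add A B)
end

section
/- For every l ∈ (0,1) there is a constant C, depending only on l, such that the following holds. Let 0 < T ≤ 1 and let u : [0,1] × [0,T] → ℝ have continuous partial derivatives uₓ, uₓₓ and uₜ on [0,1] × [0,T], with |u|^{(l+2)} finite. Then |u|^{(l+1)} ≤ C (T^δ |u|^{(l+2)} + ‖u(·,0)‖_{C²([0,1])}), where δ = min{l/2, (1−l)/2}. -/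
open scoped ENNReal

/-- Sup norm of `v` over `[0,1] × [0,T]`, valued in `ℝ≥0∞`. -/
noncomputable def supNorm (T : ℝ) (v : ℝ → ℝ → ℝ) : ℝ≥0∞ :=
  ⨆ x ∈ Set.Icc (0 : ℝ) 1, ⨆ t ∈ Set.Icc (0 : ℝ) T, ENNReal.ofReal |v x t|

/-- Spatial Hölder seminorm `⟨v⟩^β_x` over `[0,1] × [0,T]`, valued in `ℝ≥0∞`. -/
noncomputable def semX (T β : ℝ) (v : ℝ → ℝ → ℝ) : ℝ≥0∞ :=
  ⨆ x ∈ Set.Icc (0 : ℝ) 1, ⨆ x' ∈ Set.Icc (0 : ℝ) 1, ⨆ t ∈ Set.Icc (0 : ℝ) T,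
    ⨆ _ : x ≠ x', ENNReal.ofReal (|v x t - v x' t| / |x - x'| ^ β)

/-- Temporal Hölder seminorm `⟨v⟩^β_t` over `[0,1] × [0,T]`, valued in `ℝ≥0∞`. -/
noncomputable def semT (T β : ℝ) (v : ℝ → ℝ → ℝ) : ℝ≥0∞ :=
  ⨆ x ∈ Set.Icc (0 : ℝ) 1, ⨆ t ∈ Set.Icc (0 : ℝ) T, ⨆ t' ∈ Set.Icc (0 : ℝ) T,
    ⨆ _ : t ≠ t', ENNReal.ofReal (|v x t - v x t'| / |t - t'| ^ β)

/-- The parabolic Hölder norm `|u|^{(l+1)}` on `[0,1] × [0,T]`. -/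
noncomputable def pNorm1 (l T : ℝ) (u ux : ℝ → ℝ → ℝ) : ℝ≥0∞ :=
  supNorm T u + supNorm T ux + semX T l ux + semT T ((l + 1) / 2) u + semT T (l / 2) ux

/-- The parabolic Hölder norm `|u|^{(l+2)}` on `[0,1] × [0,T]`. -/
noncomputable def pNorm2 (l T : ℝ) (u ux uxx ut : ℝ → ℝ → ℝ) : ℝ≥0∞ :=
  supNorm T u + supNorm T ux + supNorm T uxx + supNorm T ut +
  semX T l ux + semX T l uxx + semX T l ut +
  semT T (l / 2) ut + semT T ((l + 1) / 2) ux + semT T (l / 2) uxx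

/-- The `C²([0,1])` norm of the initial profile `u(·,0)`. -/
noncomputable def c2Norm0 (u ux uxx : ℝ → ℝ → ℝ) : ℝ≥0∞ :=
  (⨆ x ∈ Set.Icc (0 : ℝ) 1, ENNReal.ofReal |u x 0|) +
  (⨆ x ∈ Set.Icc (0 : ℝ) 1, ENNReal.ofReal |ux x 0|) +
  (⨆ x ∈ Set.Icc (0 : ℝ) 1, ENNReal.ofReal |uxx x 0|)


lemma supNorm_pt {T N : ℝ} (hN : 0 ≤ N) {v : ℝ → ℝ → ℝ} (h : supNorm T v ≤ ENNReal.ofReal N)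
    {x t : ℝ} (hx : x ∈ Set.Icc (0 : ℝ) 1) (ht : t ∈ Set.Icc (0 : ℝ) T) : |v x t| ≤ N := by
  simp only [supNorm, iSup_le_iff] at h
  exact (ENNReal.ofReal_le_ofReal_iff hN).1 (h x hx t ht)

lemma semT_pt {T N β : ℝ} (hN : 0 ≤ N) (hβ : 0 < β) {v : ℝ → ℝ → ℝ}
    (h : semT T β v ≤ ENNReal.ofReal N)
    {x t t' : ℝ} (hx : x ∈ Set.Icc (0 : ℝ) 1) (ht : t ∈ Set.Icc (0 : ℝ) T)
    (ht' : t' ∈ Set.Icc (0 : ℝ) T) : |v x t - v x t'| ≤ N * |t - t'| ^ β := by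
  by_cases hne : t = t'
  · subst hne
    simp [Real.zero_rpow hβ.ne']
  simp only [semT, iSup_le_iff] at h
  have h1 := (ENNReal.ofReal_le_ofReal_iff hN).1 (h x hx t ht t' ht' hne)
  have : 0 < |t - t'| ^ β := Real.rpow_pos_of_pos (abs_pos.2 (sub_ne_zero.2 hne)) _
  exact (div_le_iff₀ this).1 h1

lemma sup0_pt {K : ℝ} (hK : 0 ≤ K) {v : ℝ → ℝ → ℝ}
    (h : (⨆ x ∈ Set.Icc (0 : ℝ) 1, ENNReal.ofReal |v x 0|) ≤ ENNReal.ofReal K)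
    {x : ℝ} (hx : x ∈ Set.Icc (0 : ℝ) 1) : |v x 0| ≤ K := by
  simp only [iSup_le_iff] at h
  exact (ENNReal.ofReal_le_ofReal_iff hK).1 (h x hx)

lemma mvt_pt {f f' : ℝ → ℝ} {a b M : ℝ}
    (h : ∀ x ∈ Set.Icc a b, HasDerivWithinAt f (f' x) (Set.Icc a b) x)
    (hM : ∀ x ∈ Set.Icc a b, |f' x| ≤ M) {x y : ℝ} (hx : x ∈ Set.Icc a b)
    (hy : y ∈ Set.Icc a b) : |f x - f y| ≤ M * |x - y| := by
  have := (convex_Icc a b).norm_image_sub_le_of_norm_hasDerivWithin_le h hM hy hx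
  simpa [Real.norm_eq_abs] using this

/-- `s ^ a ≤ T ^ d * s ^ b` when `s ≤ T ≤ 1` and `a ≥ b + d`. -/
lemma rpow_split {s T a b d : ℝ} (hs : 0 < s) (hsT : s ≤ T) (hT : T ≤ 1) (hd : 0 ≤ d)
    (h : b + d ≤ a) : s ^ a ≤ T ^ d * s ^ b := by
  calc s ^ a ≤ s ^ (d + b) :=
        Real.rpow_le_rpow_of_exponent_ge hs (hsT.trans hT) (by linarith)
    _ = s ^ d * s ^ b := Real.rpow_add hs _ _
    _ ≤ T ^ d * s ^ b := by
        gcongr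

lemma rpow_split0 {s T a d : ℝ} (hs : 0 ≤ s) (hsT : s ≤ T) (hT : T ≤ 1) (hd : 0 < d)
    (h : d ≤ a) : s ^ a ≤ T ^ d := by
  rcases hs.eq_or_lt with rfl | hs
  · rw [Real.zero_rpow (by linarith)]
    positivity
  · simpa using rpow_split (b := 0) hs hsT hT hd.le (by linarith)

theorem stmt_17 (l : ℝ) (hl : l ∈ Set.Ioo (0 : ℝ) 1) :
    ∃ C : ℝ, 0 < C ∧
      ∀ T : ℝ, 0 < T → T ≤ 1 →
      ∀ u ux uxx ut : ℝ → ℝ → ℝ,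
        (∀ t ∈ Set.Icc (0 : ℝ) T, ∀ x ∈ Set.Icc (0 : ℝ) 1,
          HasDerivWithinAt (fun y => u y t) (ux x t) (Set.Icc (0 : ℝ) 1) x) →
        (∀ t ∈ Set.Icc (0 : ℝ) T, ∀ x ∈ Set.Icc (0 : ℝ) 1,
          HasDerivWithinAt (fun y => ux y t) (uxx x t) (Set.Icc (0 : ℝ) 1) x) →
        (∀ t ∈ Set.Icc (0 : ℝ) T, ∀ x ∈ Set.Icc (0 : ℝ) 1,
          HasDerivWithinAt (fun τ => u x τ) (ut x t) (Set.Icc (0 : ℝ) T) t) →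
        ContinuousOn (fun p : ℝ × ℝ => ux p.1 p.2) (Set.Icc 0 1 ×ˢ Set.Icc 0 T) →
        ContinuousOn (fun p : ℝ × ℝ => uxx p.1 p.2) (Set.Icc 0 1 ×ˢ Set.Icc 0 T) →
        ContinuousOn (fun p : ℝ × ℝ => ut p.1 p.2) (Set.Icc 0 1 ×ˢ Set.Icc 0 T) →
        pNorm2 l T u ux uxx ut ≠ ⊤ →
        pNorm1 l T u ux ≤
          ENNReal.ofReal C *
            (ENNReal.ofReal (T ^ min (l / 2) ((1 - l) / 2)) * pNorm2 l T u ux uxx ut +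
              c2Norm0 u ux uxx) := by
  obtain ⟨hl0, hl1⟩ := hl
  refine ⟨5, by norm_num, ?_⟩
  intro T hT0 hT1 u ux uxx ut hux huxx hut _ _ _ hfin
  set d := min (l / 2) ((1 - l) / 2) with hd
  have hd0 : 0 < d := lt_min (by linarith) (by linarith)
  have hd1 : d ≤ l / 2 := min_le_left _ _
  have hd2 : d ≤ (1 - l) / 2 := min_le_right _ _
  by_cases hKt : c2Norm0 u ux uxx = ⊤
  · rw [hKt, add_top, ENNReal.mul_top (by simp)]
    exact le_top
  obtain ⟨N, hN, hNe⟩ : ∃ N : ℝ, 0 ≤ N ∧ pNorm2 l T u ux uxx ut = ENNReal.ofReal N :=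
    ⟨_, ENNReal.toReal_nonneg, (ENNReal.ofReal_toReal hfin).symm⟩
  obtain ⟨K, hK, hKe⟩ : ∃ K : ℝ, 0 ≤ K ∧ c2Norm0 u ux uxx = ENNReal.ofReal K :=
    ⟨_, ENNReal.toReal_nonneg, (ENNReal.ofReal_toReal hKt).symm⟩
  have bUxx0 : ∀ x ∈ Set.Icc (0 : ℝ) 1, |uxx x 0| ≤ K := fun x hx => sup0_pt hK
    (by rw [← hKe, c2Norm0]; exact le_add_self) hx
  have bUx0 : ∀ x ∈ Set.Icc (0 : ℝ) 1, |ux x 0| ≤ K := fun x hx => sup0_pt hK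
    (by rw [← hKe, c2Norm0]; exact le_add_self.trans le_self_add) hx
  have bU0 : ∀ x ∈ Set.Icc (0 : ℝ) 1, |u x 0| ≤ K := fun x hx => sup0_pt hK
    (by rw [← hKe, c2Norm0]; exact le_self_add.trans le_self_add) hx
  have nUxx : semT T (l / 2) uxx ≤ ENNReal.ofReal N := by
    rw [← hNe, pNorm2]; exact le_add_self
  have nUx : semT T ((l + 1) / 2) ux ≤ ENNReal.ofReal N := by
    rw [← hNe, pNorm2]; exact le_add_self.trans le_self_add
  have nUt : supNorm T ut ≤ ENNReal.ofReal N := by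
    rw [← hNe, pNorm2]
    refine le_trans ?_ (le_self_add.trans (le_self_add.trans (le_self_add.trans
      (le_self_add.trans (le_self_add.trans le_self_add)))))
    exact le_add_self
  have h0 : (0 : ℝ) ∈ Set.Icc (0 : ℝ) T := ⟨le_rfl, hT0.le⟩
  have dist_le : ∀ t ∈ Set.Icc (0 : ℝ) T, ∀ t' ∈ Set.Icc (0 : ℝ) T, |t - t'| ≤ T := by
    intro t ht t' ht'
    rw [abs_le]; constructor <;> linarith [ht.1, ht.2, ht'.1, ht'.2]
  set R := T ^ d * N + K with hR
  have hTd : 0 ≤ T ^ d := by positivity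
  -- pointwise consequences
  have start : ∀ (v : ℝ → ℝ → ℝ) (a : ℝ), d ≤ a → (∀ x ∈ Set.Icc (0 : ℝ) 1, |v x 0| ≤ K) →
      (∀ x ∈ Set.Icc (0 : ℝ) 1, ∀ t ∈ Set.Icc (0 : ℝ) T, ∀ t' ∈ Set.Icc (0 : ℝ) T,
        |v x t - v x t'| ≤ N * |t - t'| ^ a) →
      ∀ x ∈ Set.Icc (0 : ℝ) 1, ∀ t ∈ Set.Icc (0 : ℝ) T, |v x t| ≤ R := by
    intro v a ha hv0 hv x hx t ht
    have h1 := hv x hx t ht 0 h0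
    have h2 := rpow_split0 (abs_nonneg (t - 0)) (dist_le t ht 0 h0) hT1 hd0 ha
    have h3 := mul_le_mul_of_nonneg_left h2 hN
    have h4 := abs_sub_abs_le_abs_sub (v x t) (v x 0)
    have h5 := hv0 x hx
    rw [hR]
    linarith
  have semb : ∀ (v : ℝ → ℝ → ℝ) (a b : ℝ), b + d ≤ a →
      (∀ x ∈ Set.Icc (0 : ℝ) 1, ∀ t ∈ Set.Icc (0 : ℝ) T, ∀ t' ∈ Set.Icc (0 : ℝ) T,
        |v x t - v x t'| ≤ N * |t - t'| ^ a) → semT T b v ≤ ENNReal.ofReal R := by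
    intro v a b hab hv
    simp only [semT, iSup_le_iff]
    intro x hx t ht t' ht' hne
    apply ENNReal.ofReal_le_ofReal
    have hp : 0 < |t - t'| := abs_pos.2 (sub_ne_zero.2 hne)
    rw [div_le_iff₀ (Real.rpow_pos_of_pos hp _)]
    have h1 := hv x hx t ht t' ht'
    have h2 := rpow_split hp (dist_le t ht t' ht') hT1 hd0.le hab
    have h3 := mul_le_mul_of_nonneg_left h2 hN
    have h4 : 0 ≤ K * |t - t'| ^ b := by positivity
    rw [hR]
    linarith
  have hu : ∀ x ∈ Set.Icc (0 : ℝ) 1, ∀ t ∈ Set.Icc (0 : ℝ) T, ∀ t' ∈ Set.Icc (0 : ℝ) T,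
        |u x t - u x t'| ≤ N * |t - t'| ^ (1 : ℝ) := by
    intro x hx t ht t' ht'
    rw [Real.rpow_one]
    exact mvt_pt (f := fun τ => u x τ) (f' := fun τ => ut x τ) (fun s hs => hut s hs x hx)
      (fun s hs => supNorm_pt hN nUt hx hs) ht ht'
  have hux' : ∀ x ∈ Set.Icc (0 : ℝ) 1, ∀ t ∈ Set.Icc (0 : ℝ) T, ∀ t' ∈ Set.Icc (0 : ℝ) T,
        |ux x t - ux x t'| ≤ N * |t - t'| ^ ((l + 1) / 2) :=
    fun x hx t ht t' ht' => semT_pt hN (by linarith) nUx hx ht ht'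
  have huxx' : ∀ x ∈ Set.Icc (0 : ℝ) 1, ∀ t ∈ Set.Icc (0 : ℝ) T, ∀ t' ∈ Set.Icc (0 : ℝ) T,
        |uxx x t - uxx x t'| ≤ N * |t - t'| ^ (l / 2) :=
    fun x hx t ht t' ht' => semT_pt hN (by linarith) nUxx hx ht ht'
  have supb : ∀ (v : ℝ → ℝ → ℝ), (∀ x ∈ Set.Icc (0 : ℝ) 1, ∀ t ∈ Set.Icc (0 : ℝ) T,
      |v x t| ≤ R) → supNorm T v ≤ ENNReal.ofReal R := by
    intro v hv
    simp only [supNorm, iSup_le_iff]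
    exact fun x hx t ht => ENNReal.ofReal_le_ofReal (hv x hx t ht)
  have p1 := supb u (start u 1 (by linarith) bU0 hu)
  have p2 := supb ux (start ux _ (by linarith) bUx0 hux')
  have q := start uxx _ hd1 bUxx0 huxx'
  have hR0 : 0 ≤ R := by positivity
  have p3 : semX T l ux ≤ ENNReal.ofReal R := by
    simp only [semX, iSup_le_iff]
    intro x hx x' hx' t ht hne
    apply ENNReal.ofReal_le_ofReal
    have hp : 0 < |x - x'| := abs_pos.2 (sub_ne_zero.2 hne)
    rw [div_le_iff₀ (Real.rpow_pos_of_pos hp _)]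
    have h1 := mvt_pt (f := fun y => ux y t) (f' := fun y => uxx y t) (fun s hs => huxx t ht s hs)
      (fun s hs => q s hs t ht) hx hx'
    have hle : |x - x'| ≤ 1 := by
      rw [abs_le]; constructor <;> linarith [hx.1, hx.2, hx'.1, hx'.2]
    have h2 : |x - x'| ≤ |x - x'| ^ l := by
      simpa using Real.rpow_le_rpow_of_exponent_ge hp hle hl1.le
    exact h1.trans (mul_le_mul_of_nonneg_left h2 hR0)
  have p4 := semb u 1 ((l + 1) / 2) (by linarith) hu
  have p5 := semb ux ((l + 1) / 2) (l / 2) (by linarith) hux'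
  have e : ENNReal.ofReal 5 * (ENNReal.ofReal (T ^ d) * pNorm2 l T u ux uxx ut +
      c2Norm0 u ux uxx) = ENNReal.ofReal R + ENNReal.ofReal R + ENNReal.ofReal R
        + ENNReal.ofReal R + ENNReal.ofReal R := by
    rw [hNe, hKe, ← ENNReal.ofReal_mul hTd, ← ENNReal.ofReal_add (by positivity) hK,
      ← ENNReal.ofReal_mul (by norm_num), ← hR, ← ENNReal.ofReal_add (by positivity) hR0,
      ← ENNReal.ofReal_add (by positivity) hR0, ← ENNReal.ofReal_add (by positivity) hR0,
      ← ENNReal.ofReal_add (by positivity) hR0]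
    congr 1
    ring
  rw [e, pNorm1]
  gcongr
end

section
/- Let α ∈ ℝ, ρ₁ ≠ ρ₂, T > 0, and let s : [0,T] → (0,1) be differentiable. Set Q⁻ = {(x,t) : t ∈ [0,T], 0 ≤ x ≤ s(t)} and Q⁺ = {(x,t) : t ∈ [0,T], s(t) ≤ x ≤ 1}. Suppose ρ⁻ is continuous on Q⁻ together with ∂ₓρ⁻, ∂ₜρ⁻ and ∂ₓ(D(α,ρ⁻)∂ₓρ⁻), satisfying ∂ₜρ⁻ = ∂ₓ(D(α,ρ⁻)∂ₓρ⁻) on Q⁻, ∂ₓρ⁻(0,t) = 0 and ρ⁻(s(t),t) = ρ₁ for all t; similarly suppose ρ⁺ is continuous on Q⁺ together with its corresponding derivatives, satisfying ∂ₜρ⁺ = ∂ₓ(D(α,ρ⁺)∂ₓρ⁺) on Q⁺, ∂ₓρ⁺(1,t) = 0 and ρ⁺(s(t),t) = ρ₂ for all t. If the total mass t ↦ ∫₀^{s(t)} ρ⁻(x,t) dx + ∫_{s(t)}^1 ρ⁺(x,t) dx is constant on [0,T], then for every t ∈ [0,T] the jump location satisfies the Rankine–Hugoniot condition s′(t) =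 −(D(α,ρ₂) ∂ₓρ⁺(s(t),t) − D(α,ρ₁) ∂ₓρ⁻(s(t),t))/(ρ₂ − ρ₁), i.e. s′(t)(ρ₂ − ρ₁) = J⁺(t) − J⁻(t) where J^∓(t) = −D(α,ρ^∓(s(t),t)) ∂ₓρ^∓(s(t),t) are the one-sided fluxes at the discontinuity. -/
open MeasureTheory

/-- Crossing estimate. -/
lemma cross_est (T c K x : ℝ) (s : ℝ → ℝ) (r rt : ℝ → ℝ → ℝ)
    (hsc : ContinuousOn s (Set.Icc 0 T))
    (hx : 0 ≤ x) (hK : ∀ τ ∈ Set.Icc (0 : ℝ) T, x ∈ Set.Icc 0 (s τ) → ‖rt x τ‖ ≤ K)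
    (hrt : ∀ t ∈ Set.Icc (0 : ℝ) T, ∀ x ∈ Set.Icc 0 (s t),
      HasDerivWithinAt (fun τ => r x τ) (rt x t) (Set.Icc (0 : ℝ) T) t)
    (hc : ∀ t ∈ Set.Icc (0 : ℝ) T, r (s t) t = c)
    (u σ : ℝ) (hu : u ∈ Set.Icc (0 : ℝ) T) (hσ : σ ∈ Set.Icc (0 : ℝ) T)
    (hxu : x ≤ s u) (hxσ : s σ ≤ x) : |r x u - c| ≤ K * |σ - u| := by
  have hsub : Set.uIcc u σ ⊆ Set.Icc 0 T := Set.uIcc_subset_Icc hu hσ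
  have hK0 : 0 ≤ K := (norm_nonneg _).trans (hK u hu ⟨hx, hxu⟩)
  have ivt : ∀ τ ∈ Set.uIcc u σ, s τ ≤ x → ∃ τ' ∈ Set.uIcc u τ, s τ' = x := by
    intro τ hτ h
    have h1 : Set.uIcc u τ ⊆ Set.Icc 0 T := Set.uIcc_subset_Icc hu (hsub hτ)
    obtain ⟨τ', h2, h3⟩ := intermediate_value_uIcc (hsc.mono h1)
      (Set.mem_uIcc.2 (Or.inr ⟨h, hxu⟩))
    exact ⟨τ', h2, h3⟩
  have hScomp : IsCompact (Set.uIcc u σ ∩ s ⁻¹' {x}) :=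
    isCompact_uIcc.of_isClosed_subset
      ((hsc.mono hsub).preimage_isClosed_of_isClosed isClosed_Icc isClosed_singleton)
      Set.inter_subset_left
  obtain ⟨τ', h2, h3⟩ := ivt σ Set.right_mem_uIcc hxσ
  obtain ⟨σ0, ⟨hσ0, hσ0x⟩, hmin⟩ := hScomp.exists_isMinOn ⟨τ', h2, h3⟩
    (f := fun τ => |τ - u|) (by fun_prop)
  have hσ0x : s σ0 = x := hσ0x
  have habs : ∀ {a b : ℝ}, a ∈ Set.uIcc u b → |a - u| ≤ |b - u| := fun h =>
    Set.abs_sub_left_of_mem_uIcc h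
  have hsub0 : Set.uIcc u σ0 ⊆ Set.uIcc u σ := Set.uIcc_subset_uIcc_left hσ0
  have hge : ∀ τ ∈ Set.uIcc u σ0, x ≤ s τ := by
    intro τ hτ
    by_contra! hlt
    obtain ⟨τ1, h4, h5⟩ := ivt τ (hsub0 hτ) hlt.le
    have h6 : τ1 ∈ Set.uIcc u σ := Set.uIcc_subset_uIcc_left (hsub0 hτ) h4
    have h7 : |σ0 - u| ≤ |τ1 - u| := hmin ⟨h6, h5⟩
    have h8 := habs hτ
    have h9 : τ1 = τ := by
      rcases Set.mem_uIcc.1 h4 with h | h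
      · rw [abs_of_nonneg (by linarith : 0 ≤ τ1 - u)] at h7
        rw [abs_of_nonneg (by linarith : 0 ≤ τ - u)] at h8
        linarith
      · rw [abs_of_nonpos (by linarith : τ1 - u ≤ 0)] at h7
        rw [abs_of_nonpos (by linarith : τ - u ≤ 0)] at h8
        linarith
    subst h9; linarith
  have hmv := Convex.norm_image_sub_le_of_norm_hasDerivWithin_le (f := fun τ => r x τ)
    (f' := fun τ => rt x τ) (C := K) (s := Set.uIcc u σ0) (x := σ0) (y := u)
    (fun τ hτ => (hrt τ (hsub (hsub0 hτ)) x ⟨hx, hge τ hτ⟩).mono (hsub0.trans hsub))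
    (fun τ hτ => hK τ (hsub (hsub0 hτ)) ⟨hx, hge τ hτ⟩) (convex_uIcc _ _)
    Set.right_mem_uIcc Set.left_mem_uIcc
  have h10 : r x σ0 = c := by rw [← hσ0x]; exact hc σ0 (hsub hσ0)
  simp only [h10, Real.norm_eq_abs] at hmv
  rw [abs_sub_comm u σ0] at hmv
  exact hmv.trans (mul_le_mul_of_nonneg_left (habs hσ0) hK0)

/-- Leibniz rule on a non-cylindrical domain. -/
lemma leibniz (T c : ℝ) (s s' : ℝ → ℝ) (r rt : ℝ → ℝ → ℝ)
    (hsin : ∀ t ∈ Set.Icc (0 : ℝ) T, s t ∈ Set.Ioo (0 : ℝ) 1)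
    (hsd : ∀ t ∈ Set.Icc (0 : ℝ) T, HasDerivWithinAt s (s' t) (Set.Icc (0 : ℝ) T) t)
    (Q : Set (ℝ × ℝ))
    (hQ : Q = {p : ℝ × ℝ | p.2 ∈ Set.Icc (0 : ℝ) T ∧ p.1 ∈ Set.Icc 0 (s p.2)})
    (hrc : ContinuousOn (fun p : ℝ × ℝ => r p.1 p.2) Q)
    (hrtc : ContinuousOn (fun p : ℝ × ℝ => rt p.1 p.2) Q)
    (hrt : ∀ t ∈ Set.Icc (0 : ℝ) T, ∀ x ∈ Set.Icc 0 (s t),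
      HasDerivWithinAt (fun τ => r x τ) (rt x t) (Set.Icc (0 : ℝ) T) t)
    (hc : ∀ t ∈ Set.Icc (0 : ℝ) T, r (s t) t = c)
    (t : ℝ) (ht : t ∈ Set.Icc (0 : ℝ) T) :
    HasDerivWithinAt (fun τ => ∫ x in (0 : ℝ)..(s τ), r x τ)
      (s' t * c + ∫ x in (0 : ℝ)..(s t), rt x t) (Set.Icc 0 T) t := by
  have hsc : ContinuousOn s (Set.Icc 0 T) := fun τ hτ => (hsd τ hτ).continuousWithinAt
  -- slices
  have hslice : ∀ f : ℝ → ℝ → ℝ, ContinuousOn (fun p : ℝ × ℝ => f p.1 p.2) Q →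
      ∀ τ ∈ Set.Icc (0 : ℝ) T, IntervalIntegrable (fun x => f x τ) volume 0 (s τ) := by
    intro f hf τ hτ
    apply ContinuousOn.intervalIntegrable_of_Icc (hsin τ hτ).1.le
    exact hf.comp (f := fun x : ℝ => (x, τ)) (by fun_prop) (fun x hx => by rw [hQ]; exact ⟨hτ, hx⟩)
  -- bound
  obtain ⟨K, hK⟩ : ∃ K, ∀ τ ∈ Set.Icc (0 : ℝ) T, ∀ x ∈ Set.Icc 0 (s τ), ‖rt x τ‖ ≤ K := by
    have hcomp : IsCompact (Set.Icc (0 : ℝ) 1 ×ˢ Set.Icc (0 : ℝ) T) := isCompact_Icc.prod isCompact_Icc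
    have hcs : ContinuousOn (fun p : ℝ × ℝ => s p.2) (Set.Icc (0 : ℝ) 1 ×ˢ Set.Icc (0 : ℝ) T) :=
      hsc.comp (by fun_prop) (fun p hp => hp.2)
    obtain ⟨K, hK⟩ := hcomp.exists_bound_of_continuousOn
      (f := fun p : ℝ × ℝ => rt (p.1 * s p.2) p.2)
      (hrtc.comp (f := fun p : ℝ × ℝ => (p.1 * s p.2, p.2)) ((continuousOn_fst.mul hcs).prodMk continuousOn_snd) (by
        rintro ⟨y, τ⟩ ⟨hy, hτ⟩
        rw [hQ]
        have h0 := (hsin τ hτ).1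
        exact ⟨hτ, mul_nonneg hy.1 h0.le, by simpa using mul_le_mul_of_nonneg_right hy.2 h0.le⟩))
    refine ⟨K, fun τ hτ x hx => ?_⟩
    have h0 := (hsin τ hτ).1
    have := hK (x / s τ, τ) ⟨⟨div_nonneg hx.1 h0.le, (div_le_one h0).2 hx.2⟩, hτ⟩
    simpa [div_mul_cancel₀ _ h0.ne'] using this
  set H : ℝ → ℝ → ℝ := fun x τ => if x ≤ s τ then r x τ - c else 0 with hH
  -- splitting of integrals over [0,1]
  have split : ∀ (f : ℝ → ℝ) (a : ℝ), a ∈ Set.Ioo (0 : ℝ) 1 → IntervalIntegrable f volume 0 a →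
      IntervalIntegrable (fun x => if x ≤ a then f x else 0) volume 0 1 ∧
      ∫ x in (0 : ℝ)..1, (if x ≤ a then f x else 0) = ∫ x in (0 : ℝ)..a, f x := by
    intro f a ha hf
    have e1 : Set.EqOn (fun x => if x ≤ a then f x else 0) f (Set.uIoc 0 a) := by
      intro x hx; rw [Set.uIoc_of_le ha.1.le] at hx; simp [hx.2]
    have e2 : Set.EqOn (fun x => if x ≤ a then f x else 0) (fun _ => 0) (Set.uIoc a 1) := by
      intro x hx; rw [Set.uIoc_of_le ha.2.le] at hx; simp [not_le.2 hx.1]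
    have i1 : IntervalIntegrable (fun x => if x ≤ a then f x else 0) volume 0 a := hf.congr e1.symm
    have i2 : IntervalIntegrable (fun x => if x ≤ a then f x else 0) volume a 1 :=
      (intervalIntegrable_const (c := (0 : ℝ))).congr e2.symm
    refine ⟨i1.trans i2, ?_⟩
    rw [← intervalIntegral.integral_add_adjacent_intervals i1 i2,
      intervalIntegral.integral_congr_ae (Filter.Eventually.of_forall fun x hx => e1 hx),
      intervalIntegral.integral_congr_ae (a := a) (Filter.Eventually.of_forall fun x hx => e2 hx)]
    simp
  have hHint : ∀ τ ∈ Set.Icc (0 : ℝ) T, IntervalIntegrable (fun x => H x τ) volume 0 1 :=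
    fun τ hτ => (split (fun x => r x τ - c) (s τ) (hsin τ hτ)
      ((hslice r hrc τ hτ).sub intervalIntegrable_const)).1
  have hHval : ∀ τ ∈ Set.Icc (0 : ℝ) T,
      ∫ x in (0 : ℝ)..(s τ), r x τ = s τ * c + ∫ x in (0 : ℝ)..1, H x τ := by
    intro τ hτ
    have := (split (fun x => r x τ - c) (s τ) (hsin τ hτ)
      ((hslice r hrc τ hτ).sub intervalIntegrable_const)).2
    rw [hH, this, intervalIntegral.integral_sub (hslice r hrc τ hτ) intervalIntegrable_const]
    simp
  -- Lipschitz estimate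
  have hLip0 : ∀ x, 0 ≤ x → ∀ u ∈ Set.Icc (0 : ℝ) T, ∀ σ ∈ Set.Icc (0 : ℝ) T, s σ ≤ x → 0 ≤ K →
      |H x u| ≤ K * |σ - u| := by
    intro x hx u hu σ hσ hs hK0
    by_cases h : x ≤ s u
    · simp only [hH, h, if_true]
      exact cross_est T c K x s r rt hsc hx (fun τ hτ h => hK τ hτ x h) hrt hc u σ hu hσ h hs
    · simp only [hH, h, if_false, abs_zero]; positivity
  have hK0 : 0 ≤ K := (norm_nonneg _).trans (hK t ht 0 ⟨le_rfl, (hsin t ht).1.le⟩)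
  have hLip : ∀ x, 0 ≤ x → ∀ u ∈ Set.Icc (0 : ℝ) T, ∀ v ∈ Set.Icc (0 : ℝ) T, u ≤ v →
      |H x v - H x u| ≤ K * (v - u) := by
    intro x hx u hu v hv huv
    by_cases h : ∃ σ ∈ Set.Icc u v, s σ ≤ x
    · obtain ⟨σ, hσ, hs⟩ := h
      have hσ' : σ ∈ Set.Icc 0 T := ⟨hu.1.trans hσ.1, hσ.2.trans hv.2⟩
      have a1 := hLip0 x hx u hu σ hσ' hs hK0
      have a2 := hLip0 x hx v hv σ hσ' hs hK0
      rw [abs_of_nonneg (by linarith [hσ.1] : 0 ≤ σ - u)] at a1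
      rw [abs_of_nonpos (by linarith [hσ.2] : σ - v ≤ 0)] at a2
      have := abs_sub (H x v) (H x u)
      linarith
    · push Not at h
      have hsub : Set.Icc u v ⊆ Set.Icc 0 T := Set.Icc_subset_Icc hu.1 hv.2
      have hmv := Convex.norm_image_sub_le_of_norm_hasDerivWithin_le (f := fun τ => r x τ)
        (f' := fun τ => rt x τ) (C := K) (s := Set.Icc u v) (x := u) (y := v)
        (fun τ hτ => (hrt τ (hsub hτ) x ⟨hx, (h τ hτ).le⟩).mono hsub)
        (fun τ hτ => hK τ (hsub hτ) x ⟨hx, (h τ hτ).le⟩) (convex_Icc _ _)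
        (Set.left_mem_Icc.2 huv) (Set.right_mem_Icc.2 huv)
      have b1 := (h u (Set.left_mem_Icc.2 huv)).le
      have b2 := (h v (Set.right_mem_Icc.2 huv)).le
      simp only [hH, b1, b2, if_true, sub_sub_sub_cancel_right]
      simpa [abs_of_nonneg (sub_nonneg.2 huv)] using hmv
  have hLip' : ∀ x, 0 ≤ x → ∀ τ ∈ Set.Icc (0 : ℝ) T, |H x τ - H x t| ≤ K * |τ - t| := by
    intro x hx τ hτ
    rcases le_total t τ with h | h
    · rw [abs_of_nonneg (sub_nonneg.2 h)]; exact hLip x hx t ht τ hτ h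
    · rw [abs_sub_comm, abs_sub_comm τ, abs_of_nonneg (sub_nonneg.2 h)]
      exact hLip x hx τ hτ t ht h
  -- derivative of the integral of H
  have hLval := (split (fun x => rt x t) (s t) (hsin t ht) (hslice rt hrtc t ht)).2
  have hmain : HasDerivWithinAt (fun τ => ∫ x in (0 : ℝ)..1, H x τ)
      (∫ x in (0 : ℝ)..(s t), rt x t) (Set.Icc 0 T) t := by
    rw [hasDerivWithinAt_iff_tendsto_slope, ← hLval]
    have hmem : ∀ᶠ τ in nhdsWithin t (Set.Icc 0 T \ {t}), τ ∈ Set.Icc 0 T \ {t} :=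
      self_mem_nhdsWithin
    have key : Filter.Tendsto
        (fun τ => ∫ x in (0 : ℝ)..1, slope (fun τ => H x τ) t τ)
        (nhdsWithin t (Set.Icc 0 T \ {t}))
        (nhds (∫ x in (0 : ℝ)..1, if x ≤ s t then rt x t else 0)) := by
      apply intervalIntegral.tendsto_integral_filter_of_dominated_convergence (fun _ => K)
      · filter_upwards [hmem] with τ hτ
        have := (((hHint τ hτ.1).sub (hHint t ht)).const_mul (τ - t)⁻¹)
        rw [intervalIntegrable_iff] at this
        exact this.aestronglyMeasurable
      · filter_upwards [hmem] with τ hτ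
        refine Filter.Eventually.of_forall fun x hx => ?_
        rw [Set.uIoc_of_le zero_le_one] at hx
        have hne : 0 < |τ - t| := abs_pos.2 (sub_ne_zero.2 hτ.2)
        rw [slope_def_field, Real.norm_eq_abs, abs_div, div_le_iff₀ hne]
        exact hLip' x hx.1.le τ hτ.1
      · exact intervalIntegrable_const
      · have hae : ∀ᵐ x : ℝ, x ≠ s t := Measure.ae_ne volume (s t)
        filter_upwards [hae] with x hxne hx
        rw [Set.uIoc_of_le zero_le_one] at hx
        rw [← hasDerivWithinAt_iff_tendsto_slope]
        rcases lt_or_gt_of_ne hxne with h | h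
        · simp only [h.le, if_true]
          have hev : ∀ᶠ τ in nhdsWithin t (Set.Icc 0 T), x < s τ :=
            (hsc t ht).eventually (lt_mem_nhds h)
          refine ((hrt t ht x ⟨hx.1.le, h.le⟩).sub_const c).congr_of_eventuallyEq ?_ (by simp [hH, h.le])
          filter_upwards [hev] with τ hτ
          simp [hH, hτ.le]
        · simp only [not_le.2 h, if_false]
          have hev : ∀ᶠ τ in nhdsWithin t (Set.Icc 0 T), s τ < x :=
            (hsc t ht).eventually (gt_mem_nhds h)
          refine (hasDerivWithinAt_const t _ (0 : ℝ)).congr_of_eventuallyEq ?_ (by simp [hH, not_le.2 h])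
          filter_upwards [hev] with τ hτ
          simp [hH, not_le.2 hτ]
    refine key.congr' ?_
    filter_upwards [hmem] with τ hτ
    simp only [slope_def_field]
    rw [intervalIntegral.integral_div, intervalIntegral.integral_sub (hHint τ hτ.1) (hHint t ht)]
  exact (((hsd t ht).mul_const c).add hmain).congr (fun τ hτ => hHval τ hτ) (hHval t ht)

theorem stmt_18 (α ρ₁ ρ₂ T : ℝ) (h12 : ρ₁ ≠ ρ₂) (hT : 0 < T)
    (s s' : ℝ → ℝ)
    (hsin : ∀ t ∈ Set.Icc (0 : ℝ) T, s t ∈ Set.Ioo (0 : ℝ) 1)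
    (hsderiv : ∀ t ∈ Set.Icc (0 : ℝ) T, HasDerivWithinAt s (s' t) (Set.Icc (0 : ℝ) T) t)
    (ρm ρmx ρmt Fmx ρp ρpx ρpt Fpx : ℝ → ℝ → ℝ)
    -- the two parabolic regions Q⁻ and Q⁺
    (Qm Qp : Set (ℝ × ℝ))
    (hQm : Qm = {p : ℝ × ℝ | p.2 ∈ Set.Icc (0 : ℝ) T ∧ p.1 ∈ Set.Icc 0 (s p.2)})
    (hQp : Qp = {p : ℝ × ℝ | p.2 ∈ Set.Icc (0 : ℝ) T ∧ p.1 ∈ Set.Icc (s p.2) 1})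
    -- continuity of ρ⁻ and its derivatives on Q⁻
    (hρmc : ContinuousOn (fun p : ℝ × ℝ => ρm p.1 p.2) Qm)
    (hρmxc : ContinuousOn (fun p : ℝ × ℝ => ρmx p.1 p.2) Qm)
    (hρmtc : ContinuousOn (fun p : ℝ × ℝ => ρmt p.1 p.2) Qm)
    (hFmxc : ContinuousOn (fun p : ℝ × ℝ => Fmx p.1 p.2) Qm)
    -- continuity of ρ⁺ and its derivatives on Q⁺
    (hρpc : ContinuousOn (fun p : ℝ × ℝ => ρp p.1 p.2) Qp)
    (hρpxc : ContinuousOn (fun p : ℝ × ℝ => ρpx p.1 p.2) Qp)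
    (hρptc : ContinuousOn (fun p : ℝ × ℝ => ρpt p.1 p.2) Qp)
    (hFpxc : ContinuousOn (fun p : ℝ × ℝ => Fpx p.1 p.2) Qp)
    -- partial derivatives of ρ⁻ on Q⁻
    (hmx : ∀ t ∈ Set.Icc (0 : ℝ) T, ∀ x ∈ Set.Icc 0 (s t),
      HasDerivWithinAt (fun y => ρm y t) (ρmx x t) (Set.Icc 0 (s t)) x)
    (hmt : ∀ t ∈ Set.Icc (0 : ℝ) T, ∀ x ∈ Set.Icc 0 (s t),
      HasDerivWithinAt (fun τ => ρm x τ) (ρmt x t) (Set.Icc (0 : ℝ) T) t)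
    (hmF : ∀ t ∈ Set.Icc (0 : ℝ) T, ∀ x ∈ Set.Icc 0 (s t),
      HasDerivWithinAt (fun y => Dcoef α (ρm y t) * ρmx y t) (Fmx x t) (Set.Icc 0 (s t)) x)
    -- partial derivatives of ρ⁺ on Q⁺
    (hpx : ∀ t ∈ Set.Icc (0 : ℝ) T, ∀ x ∈ Set.Icc (s t) 1,
      HasDerivWithinAt (fun y => ρp y t) (ρpx x t) (Set.Icc (s t) 1) x)
    (hpt : ∀ t ∈ Set.Icc (0 : ℝ) T, ∀ x ∈ Set.Icc (s t) 1,
      HasDerivWithinAt (fun τ => ρp x τ) (ρpt x t) (Set.Icc (0 : ℝ) T) t)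
    (hpF : ∀ t ∈ Set.Icc (0 : ℝ) T, ∀ x ∈ Set.Icc (s t) 1,
      HasDerivWithinAt (fun y => Dcoef α (ρp y t) * ρpx y t) (Fpx x t) (Set.Icc (s t) 1) x)
    -- the nonlinear diffusion equation in each phase
    (hPDEm : ∀ t ∈ Set.Icc (0 : ℝ) T, ∀ x ∈ Set.Icc 0 (s t), ρmt x t = Fmx x t)
    (hPDEp : ∀ t ∈ Set.Icc (0 : ℝ) T, ∀ x ∈ Set.Icc (s t) 1, ρpt x t = Fpx x t)
    -- boundary conditions
    (hBCm : ∀ t ∈ Set.Icc (0 : ℝ) T, ρmx 0 t = 0 ∧ ρm (s t) t = ρ₁)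
    (hBCp : ∀ t ∈ Set.Icc (0 : ℝ) T, ρpx 1 t = 0 ∧ ρp (s t) t = ρ₂)
    -- conservation of the total mass
    (hMass : ∀ t ∈ Set.Icc (0 : ℝ) T,
      (∫ x in (0 : ℝ)..(s t), ρm x t) + (∫ x in (s t)..(1 : ℝ), ρp x t) =
      (∫ x in (0 : ℝ)..(s 0), ρm x 0) + (∫ x in (s 0)..(1 : ℝ), ρp x 0)) :
    -- the Rankine–Hugoniot condition
    ∀ t ∈ Set.Icc (0 : ℝ) T,
      s' t = -(Dcoef α ρ₂ * ρpx (s t) t - Dcoef α ρ₁ * ρmx (s t) t) / (ρ₂ - ρ₁) ∧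
      s' t * (ρ₂ - ρ₁) =
        (-(Dcoef α (ρp (s t) t) * ρpx (s t) t)) - (-(Dcoef α (ρm (s t) t) * ρmx (s t) t)) := by
  intro t ht
  have hsc : ContinuousOn s (Set.Icc 0 T) := fun τ hτ => (hsderiv τ hτ).continuousWithinAt
  have d1 := leibniz T ρ₁ s s' ρm ρmt hsin hsderiv Qm hQm hρmc hρmtc hmt
    (fun t ht => (hBCm t ht).2) t ht
  have hmaps : Set.MapsTo (fun p : ℝ × ℝ => (1 - p.1, p.2))
      {p : ℝ × ℝ | p.2 ∈ Set.Icc (0 : ℝ) T ∧ p.1 ∈ Set.Icc 0 (1 - s p.2)} Qp := by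
    rintro ⟨x, τ⟩ ⟨h1, h2, h3⟩
    rw [hQp]
    simp only at h1 h2 h3
    exact ⟨h1, by simp only; linarith, by simp only; linarith⟩
  have d2 := leibniz T ρ₂ (fun τ => 1 - s τ) (fun τ => - s' τ) (fun x τ => ρp (1 - x) τ)
    (fun x τ => ρpt (1 - x) τ)
    (fun τ hτ => ⟨by linarith [(hsin τ hτ).2], by linarith [(hsin τ hτ).1]⟩)
    (fun τ hτ => (hsderiv τ hτ).const_sub 1) _ rfl
    (hρpc.comp (f := fun p : ℝ × ℝ => (1 - p.1, p.2)) (by fun_prop) hmaps)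
    (hρptc.comp (f := fun p : ℝ × ℝ => (1 - p.1, p.2)) (by fun_prop) hmaps)
    (fun τ hτ x hx => hpt τ hτ (1 - x) ⟨by linarith [hx.2], by linarith [hx.1]⟩)
    (fun τ hτ => by simpa using (hBCp τ hτ).2) t ht
  have hrefl : ∀ (f : ℝ → ℝ) (a : ℝ), ∫ x in (0 : ℝ)..(1 - a), f (1 - x) = ∫ x in a..1, f x := by
    intro f a
    rw [intervalIntegral.integral_comp_sub_left (fun x => f x) 1]; simp
  have e2 : (fun τ => ∫ x in (0 : ℝ)..(1 - s τ), ρp (1 - x) τ) = fun τ => ∫ x in (s τ)..1, ρp x τ :=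
    funext fun τ => hrefl (fun x => ρp x τ) (s τ)
  rw [e2, hrefl (fun x => ρpt x t) (s t)] at d2
  have hst := hsin t ht
  have i1 : ∫ x in (0 : ℝ)..(s t), ρmt x t = Dcoef α ρ₁ * ρmx (s t) t := by
    have hc1 : ContinuousOn (fun x => ρmt x t) (Set.Icc 0 (s t)) :=
      hρmtc.comp (f := fun x : ℝ => (x, t)) (by fun_prop) (fun x hx => by rw [hQm]; exact ⟨ht, hx⟩)
    rw [intervalIntegral.integral_eq_sub_of_hasDerivAt_of_le hst.1.le
      (f := fun y => Dcoef α (ρm y t) * ρmx y t)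
      (fun x hx => (hmF t ht x hx).continuousWithinAt)
      (fun x hx => by
        rw [hPDEm t ht x (Set.Ioo_subset_Icc_self hx)]
        exact (hmF t ht x (Set.Ioo_subset_Icc_self hx)).hasDerivAt (Icc_mem_nhds hx.1 hx.2))
      (hc1.intervalIntegrable_of_Icc hst.1.le)]
    simp [(hBCm t ht).1, (hBCm t ht).2]
  have i2 : ∫ x in (s t)..1, ρpt x t = - (Dcoef α ρ₂ * ρpx (s t) t) := by
    have hc1 : ContinuousOn (fun x => ρpt x t) (Set.Icc (s t) 1) :=
      hρptc.comp (f := fun x : ℝ => (x, t)) (by fun_prop) (fun x hx => by rw [hQp]; exact ⟨ht, hx⟩)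
    rw [intervalIntegral.integral_eq_sub_of_hasDerivAt_of_le hst.2.le
      (f := fun y => Dcoef α (ρp y t) * ρpx y t)
      (fun x hx => (hpF t ht x hx).continuousWithinAt)
      (fun x hx => by
        rw [hPDEp t ht x (Set.Ioo_subset_Icc_self hx)]
        exact (hpF t ht x (Set.Ioo_subset_Icc_self hx)).hasDerivAt (Icc_mem_nhds hx.1 hx.2))
      (hc1.intervalIntegrable_of_Icc hst.2.le)]
    simp [(hBCp t ht).1, (hBCp t ht).2]
  have d3 := (hasDerivWithinAt_const t (Set.Icc 0 T)
    ((∫ x in (0 : ℝ)..(s 0), ρm x 0) + (∫ x in (s 0)..(1 : ℝ), ρp x 0))).congr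
    (f₁ := fun τ => (∫ x in (0 : ℝ)..(s τ), ρm x τ) + (∫ x in (s τ)..(1 : ℝ), ρp x τ))
    hMass (hMass t ht)
  have heq := (uniqueDiffOn_Icc hT t ht).eq_deriv _ (d1.add d2) d3
  rw [i1, i2] at heq
  have hne : ρ₂ - ρ₁ ≠ 0 := sub_ne_zero.2 h12.symm
  rw [(hBCm t ht).2, (hBCp t ht).2]
  refine ⟨?_, by linarith⟩
  rw [eq_div_iff hne]; linarith
end
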